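/- Let M, N ≥ 1, ε > 0, and let S ⊆ [0, N] be a measurable set with |S| ≥ εN. Let P be a monic polynomial of degree d > 1 without constant term whose coefficients have absolute values summing to at most M. Then there exist δ = δ(ε, M, d) > 0 with (log log δ^{-1})^{-1/6} ≳_{M,d} ε, a point x ∈ ℝ, and t > δ N^{1/d} such that x ∈ S, x + t ∈ S, and x + P(t) ∈ S. -/

import Mathlib

open MeasureTheory Set

namespace PR

theorem bdd_integrable {α : Type*} [MeasurableSpace α] {μ : Measure α} {F : α → ℝ} {C : ℝ}
    {B : Set α} (hB : μ B < ⊤) (hF : Measurable F) (hb : ∀ x, |F x| ≤ C)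
    (h0 : ∀ x, x ∉ B → F x = 0) : Integrable F μ := by
  have h1 : IntegrableOn F B μ := by
    refine Measure.integrableOn_of_bounded (M := C) hB.ne hF.aestronglyMeasurable ?_
    exact Filter.Eventually.of_forall (fun x => by simpa using hb x)
  exact h1.integrable_of_forall_notMem_eq_zero h0

theorem mp_integral {α β : Type*} [MeasurableSpace α] [MeasurableSpace β] {μ : Measure α}
    {ν : Measure β} {T : α → β} (hT : MeasurePreserving T μ ν) {F : β → ℝ} (hF : Measurable F) :
    ∫ x, F (T x) ∂μ = ∫ y, F y ∂ν := by
  rw [← hT.map_eq, integral_map hT.measurable.aemeasurable hF.aestronglyMeasurable]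

/-- A Cauchy-Schwarz inequality. -/
theorem cs_ineq {α : Type*} [MeasurableSpace α] {μ : Measure α} {u F : α → ℝ} {B : Set α} {V : ℝ}
    (hV : 0 < V) (hBm : MeasurableSet B) (hB : μ B < ⊤) (hBV : (μ B).toReal ≤ V)
    (hu : Measurable u) (hub : ∀ x, |u x| ≤ 1) (hF : Measurable F) (hF2 : Integrable (fun x => F x ^ 2) μ)
    (hF1 : Integrable F μ)
    (h0 : ∀ x, x ∉ B → u x * F x = 0) :
    (∫ x, u x * F x ∂μ) ^ 2 ≤ V * ∫ x, F x ^ 2 ∂μ := by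
  set I := ∫ x, u x * F x ∂μ with hI
  set v : α → ℝ := B.indicator u with hv
  have hvm : Measurable v := hu.indicator hBm
  have hvb : ∀ x, |v x| ≤ 1 := by
    intro x
    by_cases hx : x ∈ B
    · simpa [hv, hx] using hub x
    · simp [hv, hx]
  have hvF : ∀ x, v x * F x = u x * F x := by
    intro x
    by_cases hx : x ∈ B
    · simp [hv, hx]
    · simp [hv, hx, h0 x hx]
  have hv2 : Integrable (fun x => v x ^ 2) μ := by
    refine bdd_integrable (C := 1) hB (hvm.pow_const 2) ?_ ?_
    · intro x
      have := hvb x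
      rw [abs_pow]
      exact pow_le_one₀ (abs_nonneg _) this
    · intro x hx
      simp [hv, hx]
  have hvFi : Integrable (fun x => v x * F x) μ := by
    refine hF1.bdd_mul (c := 1) hvm.aestronglyMeasurable ?_
    exact Filter.Eventually.of_forall (fun x => by simpa using hvb x)
  have hv2V : ∫ x, v x ^ 2 ∂μ ≤ V := by
    have h1 : ∫ x, v x ^ 2 ∂μ ≤ ∫ x, B.indicator (fun _ => (1:ℝ)) x ∂μ := by
      refine integral_mono hv2 ?_ ?_
      · exact (integrable_indicator_iff hBm).2 (integrableOn_const hB.ne)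
      · intro x
        by_cases hx : x ∈ B
        · simp only [hx, indicator_of_mem]
          have := hvb x
          rw [← sq_abs]
          exact pow_le_one₀ (abs_nonneg _) this
        · simp [hv, hx]
    refine h1.trans ?_
    rw [integral_indicator_const _ hBm]
    simpa [Measure.real] using hBV
  have key : 0 ≤ ∫ x, (V * F x - I * v x) ^ 2 ∂μ := integral_nonneg (fun x => sq_nonneg _)
  have e : (fun x => (V * F x - I * v x) ^ 2) =
      fun x => V ^ 2 * F x ^ 2 - 2 * V * I * (v x * F x) + I ^ 2 * v x ^ 2 := by
    funext x; ring
  have i1 : Integrable (fun x => V ^ 2 * F x ^ 2 - 2 * V * I * (v x * F x)) μ :=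
    (hF2.const_mul _).sub (hvFi.const_mul _)
  rw [e, integral_add i1 (hv2.const_mul _),
    integral_sub (hF2.const_mul _) (hvFi.const_mul _), integral_const_mul, integral_const_mul,
    integral_const_mul] at key
  simp_rw [hvF] at key
  rw [← hI] at key
  have h3 : I ^ 2 * ∫ x, v x ^ 2 ∂μ ≤ I ^ 2 * V := mul_le_mul_of_nonneg_left hv2V (sq_nonneg _)
  have h4 : V * I ^ 2 ≤ V * (V * ∫ x, F x ^ 2 ∂μ) := by nlinarith
  exact le_of_mul_le_mul_left h4 hV

/-- the trilinear form -/
noncomputable def Lam (lam : ℝ) (q χ f g h : ℝ → ℝ) : ℝ :=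
  ∫ p : ℝ × ℝ, f p.1 * g (p.1 + lam * p.2) * h (p.1 + q p.2) * χ p.2

theorem mp_shear1 (lam : ℝ) : MeasurePreserving (fun p : ℝ × ℝ => (p.1 - lam * p.2, p.2))
    (volume : Measure (ℝ × ℝ)) volume := by
  have h1 : MeasurePreserving (fun p : ℝ × ℝ => (p.1, p.2 - lam * p.1))
      ((volume : Measure ℝ).prod volume) ((volume : Measure ℝ).prod volume) := by
    refine MeasurePreserving.skew_product (MeasurePreserving.id _)
      (g := fun a c => c - lam * a) (by unfold Function.uncurry; fun_prop) ?_
    exact Filter.Eventually.of_forall (fun a => (measurePreserving_sub_right volume (lam * a)).map_eq)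
  exact (Measure.measurePreserving_swap.comp h1).comp Measure.measurePreserving_swap

theorem mp_shear2 (lam : ℝ) : MeasurePreserving
    (fun p : (ℝ × ℝ) × ℝ => (p.1.1 + lam * p.2, (p.2, p.2 - p.1.2)))
    (volume : Measure ((ℝ × ℝ) × ℝ)) (volume : Measure (ℝ × (ℝ × ℝ))) := by
  have h1 : MeasurePreserving (fun p : ℝ × (ℝ × ℝ) => (p.1, (p.2.1 + lam * p.1, p.1 - p.2.2)))
      ((volume : Measure ℝ).prod ((volume : Measure ℝ).prod volume))
      ((volume : Measure ℝ).prod ((volume : Measure ℝ).prod volume)) := by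
    refine MeasurePreserving.skew_product (MeasurePreserving.id _)
      (g := fun (a : ℝ) (c : ℝ × ℝ) => (c.1 + lam * a, a - c.2))
      (by unfold Function.uncurry; fun_prop) ?_
    refine Filter.Eventually.of_forall (fun a => ?_)
    exact ((measurePreserving_add_right volume (lam * a)).prod
      (Measure.measurePreserving_sub_left volume a)).map_eq
  have h2 := (volume_preserving_prodAssoc (α₁ := ℝ) (β₁ := ℝ) (γ₁ := ℝ))
  have h3 : MeasurePreserving (Prod.map Prod.swap id : (ℝ × ℝ) × ℝ → (ℝ × ℝ) × ℝ)
      (((volume : Measure ℝ).prod volume).prod volume) (((volume : Measure ℝ).prod volume).prod volume) :=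
    Measure.measurePreserving_swap.prod (MeasurePreserving.id _)
  have h4 := ((h2.comp h3).comp h2.symm).comp (h1.comp Measure.measurePreserving_swap)
  exact h4

noncomputable def Psi (lam : ℝ) (q χ h : ℝ → ℝ) (x m a : ℝ) : ℝ :=
  h (x + q a) * h (x + lam * m + q (a - m)) * χ a * χ (a - m)

theorem cs_twice {lam : ℝ} {q χ f g h : ℝ → ℝ} {R : ℝ}
    (hl0 : 0 ≤ lam) (hl1 : lam ≤ 1)
    (hq : Measurable q) (hqb : ∀ t ∈ Icc (0:ℝ) 1, |q t| ≤ R)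
    (hχ : Measurable χ) (hf : Measurable f) (hg : Measurable g) (hh : Measurable h)
    (hχb : ∀ t, |χ t| ≤ 1) (hfb : ∀ t, |f t| ≤ 1) (hgb : ∀ t, |g t| ≤ 1) (hhb : ∀ t, |h t| ≤ 1)
    (hχs : ∀ t, t ∉ Icc (0:ℝ) 1 → χ t = 0) (hfs : ∀ t, t ∉ Icc (0:ℝ) 2 → f t = 0)
    (hhs : ∀ t, t ∉ Icc (-1:ℝ) 3 → h t = 0) :
    (Lam lam q χ f g h) ^ 4 ≤ 36 * ∫ z : (ℝ × ℝ) × (ℝ × ℝ),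
      Psi lam q χ h z.1.1 z.1.2 z.2.1 * Psi lam q χ h z.1.1 z.1.2 z.2.2 := by
  set φ : ℝ → ℝ → ℝ := fun y t => f (y - lam * t) * h (y - lam * t + q t) * χ t with hφ
  set F : ℝ → ℝ := fun y => ∫ t, φ y t with hF
  have hφm : Measurable (fun p : ℝ × ℝ => φ p.1 p.2) := by simp only [hφ]; fun_prop
  have hφm' : ∀ y, Measurable (φ y) := fun y => by simp only [hφ]; fun_prop
  have m1 : ∀ {a b : ℝ}, |a| ≤ 1 → |b| ≤ 1 → |a * b| ≤ 1 := by
    intro a b ha hb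
    rw [abs_mul]; exact mul_le_one₀ ha (abs_nonneg _) hb
  have hφb : ∀ y t, |φ y t| ≤ 1 := fun y t => m1 (m1 (hfb _) (hhb _)) (hχb _)
  have hφt : ∀ y t, t ∉ Icc (0:ℝ) 1 → φ y t = 0 := fun y t ht => by simp [hφ, hχs t ht]
  have hφy : ∀ y t, y ∉ Icc (0:ℝ) 3 → φ y t = 0 := by
    intro y t hy
    by_cases ht : t ∈ Icc (0:ℝ) 1
    · have : f (y - lam * t) = 0 := by
        apply hfs
        intro hc
        apply hy
        have h1 : 0 ≤ lam * t := mul_nonneg hl0 ht.1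
        have h2 : lam * t ≤ 1 := mul_le_one₀ hl1 ht.1 ht.2
        exact ⟨by linarith [hc.1], by linarith [hc.2]⟩
      simp [hφ, this]
    · exact hφt y t ht
  have fin2 : ∀ a b c e : ℝ, (volume : Measure (ℝ × ℝ)) (Icc a b ×ˢ Icc c e) < ⊤ := by
    intro a b c e
    rw [Measure.volume_eq_prod, Measure.prod_prod, Real.volume_Icc, Real.volume_Icc]
    exact ENNReal.mul_lt_top ENNReal.ofReal_lt_top ENNReal.ofReal_lt_top
  have hFm : Measurable F := (hφm.stronglyMeasurable.integral_prod_right').measurable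
  have hFb : ∀ y, |F y| ≤ 1 := by
    intro y
    have h1 : |F y| ≤ ∫ t, |φ y t| := abs_integral_le_integral_abs
    have h2 : ∫ t, |φ y t| ≤ ∫ t, (Icc (0:ℝ) 1).indicator (fun _ => (1:ℝ)) t := by
      refine integral_mono_of_nonneg (Filter.Eventually.of_forall fun t => abs_nonneg _)
        ((integrable_indicator_iff measurableSet_Icc).2 (integrableOn_const (by simp))) ?_
      refine Filter.Eventually.of_forall fun t => ?_
      by_cases ht : t ∈ Icc (0:ℝ) 1
      · simpa [ht] using hφb y t
      · simp [ht, hφt y t ht]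
    rw [integral_indicator_const _ measurableSet_Icc] at h2
    simp at h2
    linarith
  have hF0 : ∀ y, y ∉ Icc (0:ℝ) 3 → F y = 0 := fun y hy => by
    simp only [hF, hφy y _ hy, integral_zero]
  -- step 1
  have e1 : Lam lam q χ f g h = ∫ y, g y * F y := by
    have hm : Measurable (fun p : ℝ × ℝ => f p.1 * g (p.1 + lam * p.2) * h (p.1 + q p.2) * χ p.2) := by
      fun_prop
    rw [Lam, ← mp_integral (mp_shear1 lam) hm]
    have : ∀ p : ℝ × ℝ, f (p.1 - lam * p.2) * g (p.1 - lam * p.2 + lam * p.2) *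
        h (p.1 - lam * p.2 + q p.2) * χ p.2 = g p.1 * φ p.1 p.2 := by
      intro p
      simp only [hφ, sub_add_cancel]; ring
    simp only [this]
    rw [Measure.volume_eq_prod, integral_prod]
    · simp only [integral_const_mul, hF]
    · refine bdd_integrable (C := 1) (fin2 0 3 0 1) (by fun_prop) (fun p => m1 (hgb _) (hφb _ _)) ?_
      intro p hp
      have : φ p.1 p.2 = 0 := by
        by_cases h1 : p.1 ∈ Icc (0:ℝ) 3
        · exact hφt _ _ (fun h2 => hp ⟨h1, h2⟩)
        · exact hφy _ _ h1
      simp [this]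
  have s1 : (Lam lam q χ f g h) ^ 2 ≤ 3 * ∫ y, F y ^ 2 := by
    rw [e1]
    refine cs_ineq (B := Icc (0:ℝ) 3) (by norm_num) measurableSet_Icc (by simp) (by simp) hg hgb hFm
      ?_ ?_ (fun y hy => by simp [hF0 y hy])
    · refine bdd_integrable (B := Icc (0:ℝ) 3) (C := 1) (by simp) (hFm.pow_const 2) ?_ (fun y hy => by simp [hF0 y hy])
      intro y
      rw [abs_pow]; exact pow_le_one₀ (abs_nonneg _) (hFb y)
    · exact bdd_integrable (B := Icc (0:ℝ) 3) (C := 1) (by simp) hFm hFb hF0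
  -- step 2
  set u : ℝ × ℝ → ℝ := fun p => f p.1 * f (p.1 + lam * p.2) with hu
  set G : ℝ × ℝ → ℝ := fun p => ∫ a, Psi lam q χ h p.1 p.2 a with hG
  have hPm : Measurable (fun p : (ℝ × ℝ) × ℝ => Psi lam q χ h p.1.1 p.1.2 p.2) := by
    unfold Psi; fun_prop
  have hPb : ∀ x m a, |Psi lam q χ h x m a| ≤ 1 := fun x m a =>
    m1 (m1 (m1 (hhb _) (hhb _)) (hχb _)) (hχb _)
  have hPa : ∀ x m a, a ∉ Icc (0:ℝ) 1 → Psi lam q χ h x m a = 0 := fun x m a ha => by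
    simp [Psi, hχs a ha]
  have hPm1 : ∀ x m a, m ∉ Icc (-1:ℝ) 1 → Psi lam q χ h x m a = 0 := by
    intro x m a hm
    by_cases ha : a ∈ Icc (0:ℝ) 1
    · have : χ (a - m) = 0 := by
        apply hχs
        intro hc
        exact hm ⟨by linarith [hc.2, ha.1], by linarith [hc.1, ha.2]⟩
      simp [Psi, this]
    · exact hPa x m a ha
  have hPx : ∀ x m a, x ∉ Icc (-1-R:ℝ) (3+R) → Psi lam q χ h x m a = 0 := by
    intro x m a hx
    by_cases ha : a ∈ Icc (0:ℝ) 1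
    · have : h (x + q a) = 0 := by
        apply hhs
        intro hc
        have := abs_le.1 (hqb a ha)
        exact hx ⟨by linarith [hc.1], by linarith [hc.2]⟩
      simp [Psi, this]
    · exact hPa x m a ha
  have hGm : Measurable G := (hPm.stronglyMeasurable.integral_prod_right').measurable
  have hGb : ∀ p, |G p| ≤ 1 := by
    intro p
    have h1 : |G p| ≤ ∫ t, |Psi lam q χ h p.1 p.2 t| := abs_integral_le_integral_abs
    have h2 : ∫ t, |Psi lam q χ h p.1 p.2 t| ≤ ∫ t, (Icc (0:ℝ) 1).indicator (fun _ => (1:ℝ)) t := by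
      refine integral_mono_of_nonneg (Filter.Eventually.of_forall fun t => abs_nonneg _)
        ((integrable_indicator_iff measurableSet_Icc).2 (integrableOn_const (by simp))) ?_
      refine Filter.Eventually.of_forall fun t => ?_
      by_cases ht : t ∈ Icc (0:ℝ) 1
      · simpa [ht] using hPb _ _ t
      · simp [ht, hPa _ _ t ht]
    rw [integral_indicator_const _ measurableSet_Icc] at h2
    simp at h2
    linarith
  have hG0 : ∀ p, p ∉ Icc (-1-R:ℝ) (3+R) ×ˢ Icc (-1:ℝ) 1 → G p = 0 := by
    intro p hp
    have : ∀ a, Psi lam q χ h p.1 p.2 a = 0 := by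
      intro a
      by_cases h1 : p.1 ∈ Icc (-1-R:ℝ) (3+R)
      · exact hPm1 _ _ _ (fun h2 => hp ⟨h1, h2⟩)
      · exact hPx _ _ _ h1
    simp only [hG, this, integral_zero]
  have e2 : ∫ y, F y ^ 2 = ∫ p : ℝ × ℝ, u p * G p := by
    have h1 : ∀ y, F y ^ 2 = ∫ w : ℝ × ℝ, φ y w.1 * φ y w.2 := by
      intro y
      rw [Measure.volume_eq_prod, integral_prod_mul, sq]
    have hm : Measurable (fun p : ℝ × (ℝ × ℝ) => φ p.1 p.2.1 * φ p.1 p.2.2) := by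
      simp only [hφ]; fun_prop
    have h2 : ∫ y, F y ^ 2 = ∫ p : ℝ × (ℝ × ℝ), φ p.1 p.2.1 * φ p.1 p.2.2 := by
      simp only [h1]
      rw [Measure.volume_eq_prod ℝ (ℝ × ℝ), integral_prod]
      refine bdd_integrable (C := 1) (B := Icc (0:ℝ) 3 ×ˢ (Icc (0:ℝ) 1 ×ˢ Icc (0:ℝ) 1)) ?_ hm
        (fun p => m1 (hφb _ _) (hφb _ _)) ?_
      · rw [Measure.prod_prod]
        exact ENNReal.mul_lt_top (by simp) (fin2 _ _ _ _)
      · intro p hp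
        by_cases h1 : p.1 ∈ Icc (0:ℝ) 3
        · by_cases h2 : p.2.1 ∈ Icc (0:ℝ) 1
          · have h3 : p.2.2 ∉ Icc (0:ℝ) 1 := fun h3 => hp ⟨h1, h2, h3⟩
            simp [hφt _ _ h3]
          · simp [hφt _ _ h2]
        · simp [hφy _ _ h1]
    rw [h2, ← mp_integral (mp_shear2 lam) hm]
    have h3 : ∀ p : (ℝ × ℝ) × ℝ, φ (p.1.1 + lam * p.2) p.2 * φ (p.1.1 + lam * p.2) (p.2 - p.1.2) =
        u p.1 * Psi lam q χ h p.1.1 p.1.2 p.2 := by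
      intro p
      have : p.1.1 + lam * p.2 - lam * (p.2 - p.1.2) = p.1.1 + lam * p.1.2 := by ring
      simp only [hφ, hu, Psi, add_sub_cancel_right, this]
      ring
    simp only [h3]
    rw [Measure.volume_eq_prod (ℝ × ℝ) ℝ, integral_prod]
    · simp only [integral_const_mul, hG]
    · refine bdd_integrable (C := 1) (B := (Icc (-1-R:ℝ) (3+R) ×ˢ Icc (-1:ℝ) 1) ×ˢ Icc (0:ℝ) 1) ?_
        (by simp only [hu]; fun_prop)
        (fun p => m1 (m1 (hfb _) (hfb _)) (hPb _ _ _)) ?_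
      · rw [Measure.prod_prod]
        exact ENNReal.mul_lt_top (fin2 _ _ _ _) (by simp)
      · intro p hp
        have : Psi lam q χ h p.1.1 p.1.2 p.2 = 0 := by
          by_cases h1 : p.2 ∈ Icc (0:ℝ) 1
          · by_cases h2 : p.1.2 ∈ Icc (-1:ℝ) 1
            · exact hPx _ _ _ (fun h3 => hp ⟨⟨h3, h2⟩, h1⟩)
            · exact hPm1 _ _ _ h2
          · exact hPa _ _ _ h1
        simp [this]
  have hum : Measurable u := by simp only [hu]; fun_prop
  have hG2 : Integrable (fun p => G p ^ 2) := by
    refine bdd_integrable (C := 1) (fin2 (-1-R) (3+R) (-1) 1) (hGm.pow_const 2) ?_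
      (fun p hp => by simp [hG0 p hp])
    intro y
    rw [abs_pow]; exact pow_le_one₀ (abs_nonneg _) (hGb y)
  have s2 : (∫ y, F y ^ 2) ^ 2 ≤ 4 * ∫ p, G p ^ 2 := by
    rw [e2]
    refine cs_ineq (B := Icc (0:ℝ) 2 ×ˢ Icc (-1:ℝ) 1) (by norm_num)
      (measurableSet_Icc.prod measurableSet_Icc) (fin2 _ _ _ _) ?_ hum
      (fun p => m1 (hfb _) (hfb _)) hGm hG2
      (bdd_integrable (C := 1) (fin2 (-1-R) (3+R) (-1) 1) hGm hGb hG0) ?_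
    · rw [Measure.volume_eq_prod, Measure.prod_prod, Real.volume_Icc, Real.volume_Icc,
        ENNReal.toReal_mul, ENNReal.toReal_ofReal (by norm_num), ENNReal.toReal_ofReal (by norm_num)]
      norm_num
    · intro p hp
      by_cases h1 : p.1 ∈ Icc (0:ℝ) 2
      · have h2 : p.2 ∉ Icc (-1:ℝ) 1 := fun h2 => hp ⟨h1, h2⟩
        have : G p = 0 := hG0 p (fun h3 => h2 h3.2)
        simp [this]
      · simp [hu, hfs _ h1]
  have e3 : ∫ p, G p ^ 2 = ∫ z : (ℝ × ℝ) × (ℝ × ℝ),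
      Psi lam q χ h z.1.1 z.1.2 z.2.1 * Psi lam q χ h z.1.1 z.1.2 z.2.2 := by
    have h1 : ∀ p, G p ^ 2 = ∫ w : ℝ × ℝ, Psi lam q χ h p.1 p.2 w.1 * Psi lam q χ h p.1 p.2 w.2 := by
      intro y
      rw [Measure.volume_eq_prod, integral_prod_mul, sq]
    simp only [h1]
    rw [Measure.volume_eq_prod (ℝ × ℝ) (ℝ × ℝ), integral_prod]
    refine bdd_integrable (C := 1)
      (B := (Icc (-1-R:ℝ) (3+R) ×ˢ Icc (-1:ℝ) 1) ×ˢ (Icc (0:ℝ) 1 ×ˢ Icc (0:ℝ) 1)) ?_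
      (by unfold Psi; fun_prop) (fun p => m1 (hPb _ _ _) (hPb _ _ _)) ?_
    · rw [Measure.prod_prod]
      exact ENNReal.mul_lt_top (fin2 _ _ _ _) (fin2 _ _ _ _)
    · intro p hp
      by_cases h1 : p.2.1 ∈ Icc (0:ℝ) 1
      · by_cases h2 : p.2.2 ∈ Icc (0:ℝ) 1
        · by_cases h3 : p.1.1 ∈ Icc (-1-R:ℝ) (3+R)
          · have h4 : p.1.2 ∉ Icc (-1:ℝ) 1 := fun h4 => hp ⟨⟨h3, h4⟩, h1, h2⟩
            simp [hPm1 _ _ _ h4]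
          · simp [hPx _ _ _ h3]
        · simp [hPa _ _ _ h2]
      · simp [hPa _ _ _ h1]
  rw [← e3]
  have hFn : 0 ≤ ∫ y, F y ^ 2 := integral_nonneg (fun y => sq_nonneg _)
  have : (Lam lam q χ f g h) ^ 4 ≤ (3 * ∫ y, F y ^ 2) ^ 2 := by
    calc (Lam lam q χ f g h) ^ 4 = ((Lam lam q χ f g h) ^ 2) ^ 2 := by ring
      _ ≤ _ := pow_le_pow_left₀ (sq_nonneg _) s1 2
  nlinarith

end PR

namespace PR

theorem sublevel (p : Polynomial ℝ) (hk : 1 ≤ |p.leadingCoeff|)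
    {σ : ℝ} (hσ : 0 ≤ σ) :
    volume {s : ℝ | |p.eval s| < σ ^ p.natDegree} ≤ ENNReal.ofReal (2 * p.natDegree * σ) := by
  classical
  set P : Polynomial ℂ := p.map (algebraMap ℝ ℂ) with hP
  have hp0 : p ≠ 0 := by
    rintro rfl
    simp at hk
    linarith
  have hsp : P.Splits := IsAlgClosed.splits P
  have hcard : P.roots.card = p.natDegree := by
    rw [← hsp.natDegree_eq_card_roots, hP, Polynomial.natDegree_map]
  have hsub : {s : ℝ | |p.eval s| < σ ^ p.natDegree} ⊆
      ⋃ z ∈ P.roots.toFinset, Metric.ball (z.re) σ := by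
    intro s hs
    by_contra hcon
    simp only [mem_iUnion, Metric.mem_ball, not_exists, not_lt, Multiset.mem_toFinset] at hcon
    have hev : P.eval (s : ℂ) = ((p.eval s : ℝ) : ℂ) := by
      rw [hP, Polynomial.eval_map_algebraMap]
      exact Polynomial.aeval_ofReal p s
    have h2 : P.eval (s : ℂ) = P.leadingCoeff * (P.roots.map (fun z => (s : ℂ) - z)).prod := by
      exact hsp.eval_eq_prod_roots (s:ℂ)
    have h3 : ‖(P.roots.map (fun z => (s : ℂ) - z)).prod‖ ≥ σ ^ P.roots.card := by
      have hall : ∀ z ∈ P.roots, σ ≤ ‖(s:ℂ) - z‖ := by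
        intro z hz
        have h4 := hcon z hz
        have h5 := Complex.abs_re_le_norm ((s:ℂ) - z)
        rw [Real.dist_eq] at h4
        simp at h5
        linarith
      revert hall
      induction P.roots using Multiset.induction_on with
      | empty => simp
      | cons a t ih =>
        intro hall
        rw [Multiset.map_cons, Multiset.prod_cons, norm_mul, Multiset.card_cons, pow_succ']
        exact mul_le_mul (hall a (by simp)) (ih (fun z hz => hall z (by simp [hz])))
          (by positivity) (norm_nonneg _)
    have h4 : |p.eval s| = ‖P.eval (s:ℂ)‖ := by rw [hev]; simp
    have h5 : ‖P.leadingCoeff‖ = |p.leadingCoeff| := by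
      rw [hP, Polynomial.leadingCoeff_map]; simp
    rw [mem_ofPred_eq, h4, h2, norm_mul, h5, ← hcard] at hs
    nlinarith [norm_nonneg ((P.roots.map (fun z => (s : ℂ) - z)).prod)]
  calc _ ≤ volume (⋃ z ∈ P.roots.toFinset, Metric.ball (z.re) σ) := measure_mono hsub
    _ ≤ ∑ z ∈ P.roots.toFinset, volume (Metric.ball (z.re) σ) := measure_biUnion_finset_le _ _
    _ = P.roots.toFinset.card * ENNReal.ofReal (2 * σ) := by
        simp [Real.volume_ball]
    _ ≤ p.natDegree * ENNReal.ofReal (2 * σ) := by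
        gcongr
        rw [← hcard]; exact Multiset.toFinset_card_le _
    _ = ENNReal.ofReal (2 * p.natDegree * σ) := by
        rw [show (2 * (p.natDegree : ℝ) * σ) = p.natDegree * (2 * σ) by ring,
          ENNReal.ofReal_mul (by positivity)]
        simp

/-- the Jacobian determinant -/
noncomputable def Dd (lam : ℝ) (q' : ℝ → ℝ) (m a b : ℝ) : ℝ :=
  q' a * q' (a - m) * q' b - q' a * q' b * q' (b - m) + q' (a - m) * q' b * q' (b - m)
    - q' a * q' (a - m) * q' (b - m) + lam * (q' a * q' (b - m) - q' (a - m) * q' b)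

theorem Dd_sublevel (lam : ℝ) (Q : Polynomial ℝ) (d : ℕ) (hd : 1 < d) (hQ : Q.Monic)
    (hQd : Q.natDegree = d) (a c : ℝ) {σ : ℝ} (hσ : 0 ≤ σ) :
    volume {m : ℝ | |Dd lam (fun t => Q.derivative.eval t) m a (c - m)| < σ ^ (3 * (d - 1))}
      ≤ ENNReal.ofReal (6 * d * σ) := by
  obtain ⟨n, rfl⟩ : ∃ n, d = n + 1 := ⟨d - 1, by omega⟩
  simp only [Nat.add_sub_cancel]
  have hn : 0 < n := by omega
  set R := Q.derivative with hR
  have hRn : R.natDegree = n := by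
    rw [hR, Polynomial.natDegree_derivative Q, hQd]; simp
  have hRl : R.leadingCoeff = n + 1 := by
    rw [Polynomial.leadingCoeff, hRn, hR, Polynomial.coeff_derivative, ← hQd,
      Polynomial.Monic.coeff_natDegree hQ, one_mul]
  set L1 : Polynomial ℝ := Polynomial.C (-1) * Polynomial.X + Polynomial.C a with hL1
  set L2 : Polynomial ℝ := Polynomial.C (-1) * Polynomial.X + Polynomial.C c with hL2
  set L3 : Polynomial ℝ := Polynomial.C (-2) * Polynomial.X + Polynomial.C c with hL3
  have d1 : L1.natDegree = 1 := Polynomial.natDegree_linear (by norm_num)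
  have d2 : L2.natDegree = 1 := Polynomial.natDegree_linear (by norm_num)
  have d3 : L3.natDegree = 1 := Polynomial.natDegree_linear (by norm_num)
  have l1 : L1.leadingCoeff = -1 := Polynomial.leadingCoeff_linear (by norm_num)
  have l2 : L2.leadingCoeff = -1 := Polynomial.leadingCoeff_linear (by norm_num)
  have l3 : L3.leadingCoeff = -2 := Polynomial.leadingCoeff_linear (by norm_num)
  set p1 := R.comp L1 with hp1
  set p2 := R.comp L2 with hp2
  set p3 := R.comp L3 with hp3
  have n1 : p1.natDegree = n := by rw [hp1, Polynomial.natDegree_comp, d1, hRn, mul_one]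
  have n2 : p2.natDegree = n := by rw [hp2, Polynomial.natDegree_comp, d2, hRn, mul_one]
  have n3 : p3.natDegree = n := by rw [hp3, Polynomial.natDegree_comp, d3, hRn, mul_one]
  have c1 : p1.leadingCoeff = (n + 1) * (-1) ^ n := by
    rw [hp1, Polynomial.leadingCoeff_comp (by omega), l1, hRl, hRn]
  have c2 : p2.leadingCoeff = (n + 1) * (-1) ^ n := by
    rw [hp2, Polynomial.leadingCoeff_comp (by omega), l2, hRl, hRn]
  have c3 : p3.leadingCoeff = (n + 1) * (-2) ^ n := by
    rw [hp3, Polynomial.leadingCoeff_comp (by omega), l3, hRl, hRn]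
  set A := R.eval a with hA
  set T := p1 * p2 * p3 with hT
  set U := Polynomial.C A * (p1 * p2) - Polynomial.C A * (p2 * p3) - Polynomial.C A * (p1 * p3)
    + (Polynomial.C (lam * A) * p3 - Polynomial.C lam * (p1 * p2)) with hU
  have cT : T.leadingCoeff = (n + 1) ^ 3 * ((-1) ^ n * (-1) ^ n * (-2) ^ n) := by
    rw [hT, Polynomial.leadingCoeff_mul, Polynomial.leadingCoeff_mul, c1, c2, c3]; ring
  have ne : ∀ p : Polynomial ℝ, p.natDegree = n → p ≠ 0 := by
    rintro p hp rfl
    simp at hp; omega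
  have nT : T.natDegree = 3 * n := by
    rw [hT, Polynomial.natDegree_mul (mul_ne_zero (ne _ n1) (ne _ n2)) (ne _ n3),
      Polynomial.natDegree_mul (ne _ n1) (ne _ n2), n1, n2, n3]; ring
  have b2 : ∀ p q : Polynomial ℝ, p.natDegree = n → q.natDegree = n → (p * q).natDegree ≤ 2 * n := by
    intro p q hp hq
    refine Polynomial.natDegree_mul_le.trans ?_
    omega
  have nU : U.natDegree ≤ 2 * n := by
    have hc : ∀ (x : ℝ) (p : Polynomial ℝ), p.natDegree ≤ 2 * n →
      (Polynomial.C x * p).natDegree ≤ 2 * n := fun x p hp =>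
        (Polynomial.natDegree_C_mul_le x p).trans hp
    refine (Polynomial.natDegree_add_le _ _).trans (max_le ?_ ?_)
    · refine (Polynomial.natDegree_sub_le _ _).trans (max_le ?_ (hc _ _ (b2 _ _ n1 n3)))
      exact (Polynomial.natDegree_sub_le _ _).trans (max_le (hc _ _ (b2 _ _ n1 n2)) (hc _ _ (b2 _ _ n2 n3)))
    · exact (Polynomial.natDegree_sub_le _ _).trans (max_le (hc _ _ (by omega)) (hc _ _ (b2 _ _ n1 n2)))
  have hlt : U.natDegree < T.natDegree := by omega
  have nTU : (T + U).natDegree = 3 * n := by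
    rw [Polynomial.natDegree_add_eq_left_of_natDegree_lt hlt, nT]
  have cTU : (T + U).leadingCoeff = T.leadingCoeff := by
    rw [Polynomial.leadingCoeff_add_of_degree_lt']
    exact Polynomial.degree_lt_degree hlt
  have hev : ∀ m, Dd lam (fun t => R.eval t) m a (c - m) = (T + U).eval m := by
    intro m
    have e1 : p1.eval m = R.eval (a - m) := by
      rw [hp1, Polynomial.eval_comp]; congr 1; simp [hL1]; ring
    have e2 : p2.eval m = R.eval (c - m) := by
      rw [hp2, Polynomial.eval_comp]; congr 1; simp [hL2]; ring
    have e3 : p3.eval m = R.eval (c - m - m) := by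
      rw [hp3, Polynomial.eval_comp]; congr 1; simp [hL3]; ring
    simp only [Dd, hT, hU, Polynomial.eval_add, Polynomial.eval_sub, Polynomial.eval_mul,
      Polynomial.eval_C, e1, e2, e3, hA]
    ring
  have := sublevel (T + U) (σ := σ) ?_ hσ
  · simp only [hev]
    rw [nTU] at this
    refine this.trans (ENNReal.ofReal_le_ofReal ?_)
    push_cast
    nlinarith
  · rw [cTU, cT, abs_mul, abs_mul, abs_mul, abs_pow, abs_pow, abs_pow]
    simp only [abs_neg, abs_one, one_pow, one_mul]
    have h1 : (1:ℝ) ≤ |(n:ℝ) + 1| ^ 3 := by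
      apply one_le_pow₀
      rw [abs_of_nonneg (by positivity)]
      linarith [(Nat.cast_nonneg n : (0:ℝ) ≤ n)]
    have h2 : (1:ℝ) ≤ |(2:ℝ)| ^ n := one_le_pow₀ (by norm_num)
    nlinarith

end PR

namespace PR

theorem prod_fiber_le {β : Type*} [MeasurableSpace β] {ν : Measure β} [SFinite ν]
    {S : Set (ℝ × β)} (hS : MeasurableSet S) {I : Set ℝ} (hI : MeasurableSet I)
    {V : ENNReal} (h0 : ∀ x, x ∉ I → Prod.mk x ⁻¹' S = ∅) (h1 : ∀ x, ν (Prod.mk x ⁻¹' S) ≤ V) :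
    ((volume : Measure ℝ).prod ν) S ≤ V * volume I := by
  rw [Measure.prod_apply hS]
  calc ∫⁻ x, ν (Prod.mk x ⁻¹' S) ≤ ∫⁻ x, I.indicator (fun _ => V) x := by
        refine lintegral_mono (fun x => ?_)
        by_cases hx : x ∈ I
        · simpa [hx] using h1 x
        · simp [hx, h0 x hx]
    _ = V * volume I := by rw [lintegral_indicator_const hI]

theorem mp_perm : MeasurePreserving
    (fun p : ℝ × (ℝ × (ℝ × ℝ)) => ((p.1, p.2.2.2), (p.2.1, p.2.2.1 - 1 * p.2.2.2)))
    (volume : Measure (ℝ × (ℝ × (ℝ × ℝ)))) (volume : Measure ((ℝ × ℝ) × (ℝ × ℝ))) := by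
  have h1 := (MeasurePreserving.id (volume : Measure ℝ)).prod (mp_shear1 1)
  have h2 := (volume_preserving_prodAssoc (α₁ := ℝ) (β₁ := ℝ) (γ₁ := ℝ)).symm
  have h3 : MeasurePreserving (Prod.swap : (ℝ × ℝ) × ℝ → _) volume volume :=
    Measure.measurePreserving_swap
  have h4 := (MeasurePreserving.id (volume : Measure ℝ)).prod (h3.comp (h2.comp h1))
  have h5 := (volume_preserving_prodAssoc (α₁ := ℝ) (β₁ := ℝ) (γ₁ := ℝ × ℝ)).symm
  exact h5.comp h4

def Box (K : ℝ) : Set ((ℝ × ℝ) × (ℝ × ℝ)) :=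
  (Icc (-K) K ×ˢ Icc (-1:ℝ) 1) ×ˢ (Icc (0:ℝ) 1 ×ˢ Icc (0:ℝ) 1)

theorem Box_meas (K : ℝ) : MeasurableSet (Box K) :=
  (measurableSet_Icc.prod measurableSet_Icc).prod (measurableSet_Icc.prod measurableSet_Icc)

theorem Box_vol {K : ℝ} (hK : 0 ≤ K) : volume (Box K) = ENNReal.ofReal (4 * K) := by
  rw [Box, Measure.volume_eq_prod, Measure.prod_prod, Measure.volume_eq_prod, Measure.prod_prod,
    Measure.prod_prod, Real.volume_Icc, Real.volume_Icc, Real.volume_Icc]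
  rw [← ENNReal.ofReal_mul (by linarith), ← ENNReal.ofReal_mul (by norm_num),
    ← ENNReal.ofReal_mul (by nlinarith)]
  congr 1; ring

theorem Dd_vol (lam : ℝ) (Q : Polynomial ℝ) (d : ℕ) (hd : 1 < d) (hQ : Q.Monic)
    (hQd : Q.natDegree = d) {K σ : ℝ} (hσ : 0 ≤ σ) (hK : 0 ≤ K) :
    volume (Box K ∩ {z | |Dd lam (fun t => Q.derivative.eval t) z.1.2 z.2.1 z.2.2| < σ ^ (3 * (d - 1))})
      ≤ ENNReal.ofReal (36 * d * K * σ) := by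
  set T := (Box K ∩ {z : (ℝ × ℝ) × (ℝ × ℝ) |
    |Dd lam (fun t => Q.derivative.eval t) z.1.2 z.2.1 z.2.2| < σ ^ (3 * (d - 1))}) with hT
  have hTm : MeasurableSet T := by
    refine (Box_meas K).inter (measurableSet_lt ?_ measurable_const)
    unfold Dd
    refine Continuous.measurable ?_
    fun_prop
  rw [← mp_perm.measure_preimage hTm.nullMeasurableSet]
  have hTm' := mp_perm.measurable hTm
  set T' := (fun p : ℝ × (ℝ × (ℝ × ℝ)) => ((p.1, p.2.2.2), (p.2.1, p.2.2.1 - 1 * p.2.2.2))) ⁻¹' T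
    with hT'
  have hmem : ∀ x a c m, (x, (a, (c, m))) ∈ T' → x ∈ Icc (-K) K ∧ a ∈ Icc (0:ℝ) 1 ∧ c ∈ Icc (-1:ℝ) 2 ∧
      |Dd lam (fun t => Q.derivative.eval t) m a (c - m)| < σ ^ (3 * (d - 1)) := by
    intro x a c m h
    simp only [hT', hT, Box, mem_preimage, mem_inter_iff, mem_prod, mem_Icc, mem_ofPred_eq, one_mul] at h
    obtain ⟨⟨⟨h1, h2⟩, h3, h4⟩, h5⟩ := h
    exact ⟨h1, h3, ⟨by linarith, by linarith⟩, h5⟩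
  have key : volume T' ≤ ((ENNReal.ofReal (6 * d * σ) * volume (Icc (-1:ℝ) 2)) *
      volume (Icc (0:ℝ) 1)) * volume (Icc (-K) K) := by
    rw [Measure.volume_eq_prod]
    refine prod_fiber_le hTm' measurableSet_Icc ?_ (fun x => ?_)
    · intro x hx
      ext ⟨a, c, m⟩
      simp only [mem_preimage, mem_empty_iff_false, iff_false]
      exact fun h => hx (hmem _ _ _ _ h).1
    rw [Measure.volume_eq_prod]
    have hm1 := measurable_prodMk_left (x := x) hTm'
    refine prod_fiber_le hm1 measurableSet_Icc ?_ (fun a => ?_)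
    · intro a ha
      ext ⟨c, m⟩
      simp only [mem_preimage, mem_empty_iff_false, iff_false]
      exact fun h => ha (hmem _ _ _ _ h).2.1
    rw [Measure.volume_eq_prod]
    have hm2 := measurable_prodMk_left (x := a) hm1
    refine prod_fiber_le hm2 measurableSet_Icc ?_ (fun c => ?_)
    · intro c hc
      ext m
      simp only [mem_preimage, mem_empty_iff_false, iff_false]
      exact fun h => hc (hmem _ _ _ _ h).2.2.1
    refine (measure_mono ?_).trans (Dd_sublevel lam Q d hd hQ hQd a c hσ)
    intro m hm
    exact (hmem _ _ _ _ hm).2.2.2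
  refine key.trans (le_of_eq ?_)
  rw [Real.volume_Icc, Real.volume_Icc, Real.volume_Icc, ← ENNReal.ofReal_mul (by positivity),
    ← ENNReal.ofReal_mul (by positivity), ← ENNReal.ofReal_mul (by positivity)]
  congr 1; ring

/-- The contribution of the degenerate region. -/
theorem Dd_int (lam : ℝ) (Q : Polynomial ℝ) (d : ℕ) (hd : 1 < d) (hQ : Q.Monic)
    (hQd : Q.natDegree = d) {K σ : ℝ} (hσ : 0 < σ) (hσ1 : σ ≤ 1) (hK : 0 ≤ K)
    {F : (ℝ × ℝ) × (ℝ × ℝ) → ℝ} (hF : ∀ z, z ∉ Box K → F z = 0) (hF1 : ∀ z, |F z| ≤ 1) :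
    |∫ z, F z * ((σ ^ (6 * (d - 1))) ^ 2 / ((Dd lam (fun t => Q.derivative.eval t) z.1.2 z.2.1 z.2.2) ^ 2
      + (σ ^ (6 * (d - 1))) ^ 2))| ≤ (40 * d * K) * σ := by
  set D : (ℝ × ℝ) × (ℝ × ℝ) → ℝ := fun z => Dd lam (fun t => Q.derivative.eval t) z.1.2 z.2.1 z.2.2 with hD
  set τ := σ ^ (6 * (d - 1)) with hτ
  have hτ0 : 0 < τ := by positivity
  set T := (Box K ∩ {z : (ℝ × ℝ) × (ℝ × ℝ) | |D z| < σ ^ (3 * (d - 1))}) with hT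
  have hTm : MeasurableSet T := by
    refine (Box_meas K).inter (measurableSet_lt ?_ measurable_const)
    simp only [hD]
    unfold Dd
    refine Continuous.measurable ?_
    fun_prop
  have hTv : volume T ≤ ENNReal.ofReal (36 * d * K * σ) := Dd_vol lam Q d hd hQ hQd hσ.le hK
  have hTf : volume T ≠ ⊤ := (hTv.trans_lt ENNReal.ofReal_lt_top).ne
  have hBf : volume (Box K) ≠ ⊤ := by rw [Box_vol hK]; exact ENNReal.ofReal_ne_top
  have iT : Integrable (T.indicator (fun _ => (1:ℝ))) (volume : Measure ((ℝ × ℝ) × (ℝ × ℝ))) :=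
    (integrable_indicator_iff hTm).2 (integrableOn_const hTf)
  have iB : Integrable ((Box K).indicator (fun _ => σ)) (volume : Measure ((ℝ × ℝ) × (ℝ × ℝ))) :=
    (integrable_indicator_iff (Box_meas K)).2 (integrableOn_const hBf)
  have hb : ∀ z, ‖F z * (τ ^ 2 / (D z ^ 2 + τ ^ 2))‖ ≤
      T.indicator (fun _ => (1:ℝ)) z + (Box K).indicator (fun _ => σ) z := by
    intro z
    have hfr0 : 0 ≤ τ ^ 2 / (D z ^ 2 + τ ^ 2) := by positivity
    have hfr1 : τ ^ 2 / (D z ^ 2 + τ ^ 2) ≤ 1 := by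
      rw [div_le_one (by positivity)]; nlinarith [sq_nonneg (D z)]
    rw [Real.norm_eq_abs, abs_mul, abs_of_nonneg hfr0]
    by_cases hz : z ∈ Box K
    · by_cases hz2 : |D z| < σ ^ (3 * (d - 1))
      · have : z ∈ T := ⟨hz, hz2⟩
        simp only [this, hz, indicator_of_mem]
        have := hF1 z
        nlinarith [abs_nonneg (F z)]
      · have : z ∉ T := fun h => hz2 h.2
        simp only [this, hz, indicator_of_mem, not_false_eq_true, indicator_of_notMem, zero_add]
        have h1 : τ ≤ D z ^ 2 := by
          have h2 : τ = (σ ^ (3 * (d - 1))) ^ 2 := by rw [hτ, ← pow_mul]; congr 1; ring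
          rw [h2, ← sq_abs (D z)]
          exact pow_le_pow_left₀ (by positivity) (not_lt.1 hz2) 2
        have h3 : τ ≤ σ := by
          rw [hτ]
          exact pow_le_of_le_one hσ.le hσ1 (by omega)
        have h4 : τ ^ 2 / (D z ^ 2 + τ ^ 2) ≤ σ := by
          rw [div_le_iff₀ (by positivity)]
          nlinarith [mul_pos hσ (pow_pos hτ0 2), mul_le_mul h3 h1 hτ0.le hσ.le]
        have := hF1 z
        nlinarith [abs_nonneg (F z)]
    · have : z ∉ T := fun h => hz h.1
      simp [hF z hz, this, hz]
  have h1 := norm_integral_le_of_norm_le (iT.add iB) (Filter.Eventually.of_forall hb)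
  rw [Real.norm_eq_abs] at h1
  refine h1.trans ?_
  have h2 : ∫ z, (T.indicator (fun _ => (1:ℝ)) + (Box K).indicator (fun _ => σ)) z
      = (volume T).toReal + 4 * K * σ := by
    rw [integral_add' iT iB, integral_indicator_const _ hTm, integral_indicator_const _ (Box_meas K)]
    simp [Measure.real, Box_vol hK, ENNReal.toReal_ofReal, hK]
  rw [h2]
  have h3 : (volume T).toReal ≤ 36 * d * K * σ := ENNReal.toReal_le_of_le_ofReal (by positivity) hTv
  have h4 : (1:ℝ) ≤ d := by exact_mod_cast hd.le
  have h5 : 0 ≤ K * σ := by positivity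
  nlinarith

end PR

namespace PR

abbrev EE := (ℝ × ℝ) × (ℝ × ℝ)

/-- the region where all four `t`-variables lie in `[0,1]` -/
def UU : Set EE := {z | z.2.1 ∈ Icc (0:ℝ) 1 ∧ z.2.2 ∈ Icc (0:ℝ) 1 ∧
  z.2.1 - z.1.2 ∈ Icc (0:ℝ) 1 ∧ z.2.2 - z.1.2 ∈ Icc (0:ℝ) 1}

theorem UU_closed : IsClosed UU := by
  unfold UU
  refine IsClosed.inter ?_ (IsClosed.inter ?_ (IsClosed.inter ?_ ?_))
  · exact isClosed_Icc.preimage (f := fun z : EE => z.2.1) (by fun_prop)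
  · exact isClosed_Icc.preimage (f := fun z : EE => z.2.2) (by fun_prop)
  · exact isClosed_Icc.preimage (f := fun z : EE => z.2.1 - z.1.2) (by fun_prop)
  · exact isClosed_Icc.preimage (f := fun z : EE => z.2.2 - z.1.2) (by fun_prop)

/-- bounded with bounded derivative on `UU` -/
def BD (F : EE → ℝ) (c0 c1 : ℝ) : Prop :=
  ContDiff ℝ 1 F ∧ ∀ z ∈ UU, |F z| ≤ c0 ∧ ‖fderiv ℝ F z‖ ≤ c1

theorem BD.mono {F : EE → ℝ} {c0 c1 e0 e1 : ℝ} (h : BD F c0 c1) (h0 : c0 ≤ e0) (h1 : c1 ≤ e1) :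
    BD F e0 e1 := ⟨h.1, fun z hz => ⟨(h.2 z hz).1.trans h0, (h.2 z hz).2.trans h1⟩⟩

theorem BD.diff {F : EE → ℝ} {c0 c1 : ℝ} (h : BD F c0 c1) (z : EE) : DifferentiableAt ℝ F z :=
  (h.1.differentiable (by norm_num)) z

theorem BD.mul {F G : EE → ℝ} {c0 c1 e0 e1 : ℝ} (hF : BD F c0 c1) (hG : BD G e0 e1) :
    BD (fun z => F z * G z) (c0 * e0) (c0 * e1 + e0 * c1) := by
  refine ⟨hF.1.mul hG.1, fun z hz => ?_⟩
  obtain ⟨a0, a1⟩ := hF.2 z hz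
  obtain ⟨b0, b1⟩ := hG.2 z hz
  constructor
  · rw [abs_mul]
    exact mul_le_mul a0 b0 (abs_nonneg _) ((abs_nonneg _).trans a0)
  · rw [fderiv_fun_mul (hF.diff z) (hG.diff z)]
    refine (norm_add_le _ _).trans ?_
    rw [norm_smul, norm_smul, Real.norm_eq_abs, Real.norm_eq_abs]
    exact add_le_add (mul_le_mul a0 b1 (norm_nonneg _) ((abs_nonneg _).trans a0))
      (mul_le_mul b0 a1 (norm_nonneg _) ((abs_nonneg _).trans b0))

theorem BD.add {F G : EE → ℝ} {c0 c1 e0 e1 : ℝ} (hF : BD F c0 c1) (hG : BD G e0 e1) :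
    BD (fun z => F z + G z) (c0 + e0) (c1 + e1) := by
  refine ⟨hF.1.add hG.1, fun z hz => ?_⟩
  obtain ⟨a0, a1⟩ := hF.2 z hz
  obtain ⟨b0, b1⟩ := hG.2 z hz
  constructor
  · exact (abs_add_le _ _).trans (add_le_add a0 b0)
  · rw [fderiv_fun_add (hF.diff z) (hG.diff z)]
    exact (norm_add_le _ _).trans (add_le_add a1 b1)

theorem BD.neg {F : EE → ℝ} {c0 c1 : ℝ} (hF : BD F c0 c1) :
    BD (fun z => - F z) c0 c1 := by
  refine ⟨hF.1.neg, fun z hz => ?_⟩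
  obtain ⟨a0, a1⟩ := hF.2 z hz
  refine ⟨by rwa [abs_neg], ?_⟩
  rw [fderiv_fun_neg, norm_neg]; exact a1

theorem BD.sub {F G : EE → ℝ} {c0 c1 e0 e1 : ℝ} (hF : BD F c0 c1) (hG : BD G e0 e1) :
    BD (fun z => F z - G z) (c0 + e0) (c1 + e1) := by
  simp only [sub_eq_add_neg]
  exact hF.add hG.neg

theorem BD.const (c : ℝ) : BD (fun _ => c) |c| 0 :=
  ⟨contDiff_const, fun z _ => ⟨le_rfl, by simp⟩⟩

theorem BD.comp {φ : ℝ → ℝ} {F : EE → ℝ} {c0 c1 e0 e1 : ℝ} (hF : BD F c0 c1)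
    (hφ : ContDiff ℝ 1 φ) (h : ∀ z ∈ UU, |φ (F z)| ≤ e0 ∧ |deriv φ (F z)| ≤ e1) :
    BD (fun z => φ (F z)) e0 (e1 * c1) := by
  refine ⟨hφ.comp hF.1, fun z hz => ⟨(h z hz).1, ?_⟩⟩
  have h1 : HasFDerivAt (fun z => φ (F z)) (deriv φ (F z) • fderiv ℝ F z) z :=
    ((hφ.differentiable (by norm_num)) (F z)).hasDerivAt.comp_hasFDerivAt z (hF.diff z).hasFDerivAt
  rw [h1.fderiv, norm_smul, Real.norm_eq_abs]
  exact mul_le_mul (h z hz).2 (hF.2 z hz).2 (norm_nonneg _) ((abs_nonneg _).trans (h z hz).2)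

theorem BD.lin (l : EE →L[ℝ] ℝ) (c : ℝ) (hl : ‖l‖ ≤ c) (hz : ∀ z ∈ UU, l z ∈ Icc (0:ℝ) 1) :
    BD (fun z => l z) 1 c := by
  refine ⟨l.contDiff, fun z h => ⟨?_, ?_⟩⟩
  · have := hz z h
    rw [abs_of_nonneg this.1]; exact this.2
  · rw [ContinuousLinearMap.fderiv]; exact hl

noncomputable def la : EE →L[ℝ] ℝ :=
  (ContinuousLinearMap.fst ℝ ℝ ℝ).comp (ContinuousLinearMap.snd ℝ (ℝ × ℝ) (ℝ × ℝ))
noncomputable def lb : EE →L[ℝ] ℝ :=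
  (ContinuousLinearMap.snd ℝ ℝ ℝ).comp (ContinuousLinearMap.snd ℝ (ℝ × ℝ) (ℝ × ℝ))
noncomputable def lm : EE →L[ℝ] ℝ :=
  (ContinuousLinearMap.snd ℝ ℝ ℝ).comp (ContinuousLinearMap.fst ℝ (ℝ × ℝ) (ℝ × ℝ))

theorem la_norm : ‖la‖ ≤ 1 := ContinuousLinearMap.opNorm_le_bound _ zero_le_one (fun z => by
  rw [one_mul]; exact (norm_fst_le z.2).trans (norm_snd_le z))
theorem lb_norm : ‖lb‖ ≤ 1 := ContinuousLinearMap.opNorm_le_bound _ zero_le_one (fun z => by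
  rw [one_mul]; exact (norm_snd_le z.2).trans (norm_snd_le z))
theorem lm_norm : ‖lm‖ ≤ 1 := ContinuousLinearMap.opNorm_le_bound _ zero_le_one (fun z => by
  rw [one_mul]; exact (norm_snd_le z.1).trans (norm_fst_le z))

theorem BD_a : BD (fun z => z.2.1) 1 2 :=
  BD.lin la 2 (la_norm.trans (by norm_num)) (fun _ hz => hz.1)
theorem BD_b : BD (fun z => z.2.2) 1 2 :=
  BD.lin lb 2 (lb_norm.trans (by norm_num)) (fun _ hz => hz.2.1)
theorem BD_am : BD (fun z => z.2.1 - z.1.2) 1 2 :=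
  BD.lin (la - lm) 2 ((norm_sub_le _ _).trans (by linarith [la_norm, lm_norm])) (fun _ hz => hz.2.2.1)
theorem BD_bm : BD (fun z => z.2.2 - z.1.2) 1 2 :=
  BD.lin (lb - lm) 2 ((norm_sub_le _ _).trans (by linarith [lb_norm, lm_norm])) (fun _ hz => hz.2.2.2)

/-- triple products -/
theorem BD.mul3 {F G H : EE → ℝ} {r : ℝ} (hF : BD F r r) (hG : BD G r r) (hH : BD H r r) :
    BD (fun z => F z * G z * H z) (3 * r ^ 3) (3 * r ^ 3) := by
  have h := (hF.mul hG).mul hH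
  have hr : 0 ≤ r := (abs_nonneg _).trans (hF.2 0 (by simp [UU])).1
  have : 0 ≤ r ^ 3 := by positivity
  exact h.mono (by nlinarith) (by nlinarith)

theorem fderiv_zero_off {F : EE → ℝ} {C : Set EE} (hC : IsClosed C) (h : ∀ z, z ∉ C → F z = 0)
    {z : EE} (hz : z ∉ C) : fderiv ℝ F z = 0 := by
  have : F =ᶠ[nhds z] fun _ => 0 := by
    filter_upwards [hC.isOpen_compl.mem_nhds hz] with y hy using h y hy
  rw [this.fderiv_eq]; simp

end PR

namespace PR

theorem Box_compact (K : ℝ) : IsCompact (Box K) :=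
  (isCompact_Icc.prod isCompact_Icc).prod (isCompact_Icc.prod isCompact_Icc)

theorem ibp_one {W G : EE → ℝ} {c0 c1 η K : ℝ} {C : Set EE} (hK : 0 ≤ K) (hη : 0 ≤ η)
    (hW : BD W c0 c1) (hW0 : ∀ z, z ∉ UU → W z = 0) (hG : ContDiff ℝ 1 G)
    (hC : IsClosed C) (hG0 : ∀ z, z ∉ C → G z = 0) (hGb : ∀ z, |G z| ≤ η)
    (hCU : C ∩ UU ⊆ Box K) (e : EE) (he : ‖e‖ ≤ 1) :
    Integrable (fun z => W z * fderiv ℝ G z e) ∧ |∫ z, W z * fderiv ℝ G z e| ≤ 4 * K * (c1 * η) := by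
  have cW : Continuous W := hW.1.continuous
  have cG : Continuous G := hG.continuous
  have cW' : Continuous (fun z => fderiv ℝ W z e) :=
    (hW.1.continuous_fderiv (by norm_num)).clm_apply continuous_const
  have cG' : Continuous (fun z => fderiv ℝ G z e) :=
    (hG.continuous_fderiv (by norm_num)).clm_apply continuous_const
  have z1 : ∀ z, z ∉ Box K → fderiv ℝ W z e * G z = 0 := by
    intro z hz
    by_cases h1 : z ∈ UU
    · rw [hG0 z (fun h2 => hz (hCU ⟨h2, h1⟩)), mul_zero]
    · rw [fderiv_zero_off UU_closed hW0 h1]; simp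
  have z2 : ∀ z, z ∉ Box K → W z * fderiv ℝ G z e = 0 := by
    intro z hz
    by_cases h1 : z ∈ UU
    · rw [fderiv_zero_off hC hG0 (fun h2 => hz (hCU ⟨h2, h1⟩))]; simp
    · rw [hW0 z h1, zero_mul]
  have z3 : ∀ z, z ∉ Box K → W z * G z = 0 := by
    intro z hz
    by_cases h1 : z ∈ UU
    · rw [hG0 z (fun h2 => hz (hCU ⟨h2, h1⟩)), mul_zero]
    · rw [hW0 z h1, zero_mul]
  have i1 : Integrable (fun z => fderiv ℝ W z e * G z) :=
    (cW'.mul cG).integrable_of_hasCompactSupport (HasCompactSupport.intro (Box_compact K) z1)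
  have i2 : Integrable (fun z => W z * fderiv ℝ G z e) :=
    (cW.mul cG').integrable_of_hasCompactSupport (HasCompactSupport.intro (Box_compact K) z2)
  have i3 : Integrable (fun z => W z * G z) :=
    (cW.mul cG).integrable_of_hasCompactSupport (HasCompactSupport.intro (Box_compact K) z3)
  refine ⟨i2, ?_⟩
  haveI j2 : (volume : Measure (ℝ × ℝ)).IsAddHaarMeasure := by
    rw [Measure.volume_eq_prod]; infer_instance
  haveI j4 : (volume : Measure EE).IsAddHaarMeasure := by
    rw [Measure.volume_eq_prod]; infer_instance
  rw [integral_mul_fderiv_eq_neg_fderiv_mul_of_integrable i1 i2 i3 (fun z _ => hW.diff z)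
    (fun z _ => hG.differentiable (by norm_num) z), abs_neg]
  have hBf : volume (Box K) ≠ ⊤ := by rw [Box_vol hK]; exact ENNReal.ofReal_ne_top
  have hc1 : 0 ≤ c1 := (norm_nonneg _).trans (hW.2 0 (by simp [UU])).2
  have iB : Integrable ((Box K).indicator (fun _ => c1 * η)) (volume : Measure EE) :=
    (integrable_indicator_iff (Box_meas K)).2 (integrableOn_const hBf)
  have hb : ∀ z, ‖fderiv ℝ W z e * G z‖ ≤ (Box K).indicator (fun _ => c1 * η) z := by
    intro z
    by_cases hz : z ∈ Box K
    · simp only [hz, indicator_of_mem]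
      by_cases h1 : z ∈ UU
      · rw [norm_mul]
        refine mul_le_mul ?_ (hGb z) (norm_nonneg _) hc1
        calc ‖fderiv ℝ W z e‖ ≤ ‖fderiv ℝ W z‖ * ‖e‖ := ContinuousLinearMap.le_opNorm _ _
          _ ≤ c1 * 1 := mul_le_mul (hW.2 z h1).2 he (norm_nonneg _) hc1
          _ = c1 := mul_one _
      · rw [fderiv_zero_off UU_closed hW0 h1]; simp; positivity
    · rw [z1 z hz]; simp [hz]
  have h1 := norm_integral_le_of_norm_le iB (Filter.Eventually.of_forall hb)
  rw [Real.norm_eq_abs] at h1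
  refine h1.trans (le_of_eq ?_)
  rw [integral_indicator_const _ (Box_meas K), Measure.real, Box_vol hK, ENNReal.toReal_ofReal (by positivity)]
  simp

theorem rat_bd {τ : ℝ} (hτ : 0 < τ) (hτ1 : τ ≤ 1) :
    ContDiff ℝ 1 (fun u : ℝ => u / (u ^ 2 + τ ^ 2)) ∧
    ∀ u : ℝ, |u / (u ^ 2 + τ ^ 2)| ≤ 1 / τ ^ 2 ∧
      |deriv (fun u : ℝ => u / (u ^ 2 + τ ^ 2)) u| ≤ 1 / τ ^ 2 := by
  refine ⟨contDiff_id.div (by fun_prop) (fun u => by positivity), fun u => ⟨?_, ?_⟩⟩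
  · rw [abs_div, abs_of_pos (by positivity : 0 < u ^ 2 + τ ^ 2), div_le_div_iff₀ (by positivity) (by positivity),
      one_mul]
    have h1 : |u| * τ ≤ u ^ 2 + τ ^ 2 := by
      nlinarith [sq_nonneg (|u| - τ), sq_abs u, abs_nonneg u]
    nlinarith [mul_nonneg (abs_nonneg u) hτ.le]
  · have hd : HasDerivAt (fun u : ℝ => u / (u ^ 2 + τ ^ 2))
        ((1 * (u ^ 2 + τ ^ 2) - u * (2 * u)) / (u ^ 2 + τ ^ 2) ^ 2) u := by
      have h1 : HasDerivAt (fun u : ℝ => u ^ 2 + τ ^ 2) (2 * u) u := by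
        simpa using (hasDerivAt_pow 2 u).add_const (τ ^ 2)
      exact (hasDerivAt_id u).div h1 (by positivity)
    rw [hd.deriv, abs_div, abs_of_pos (by positivity : 0 < (u ^ 2 + τ ^ 2) ^ 2),
      div_le_div_iff₀ (by positivity) (by positivity)]
    have h1 : |1 * (u ^ 2 + τ ^ 2) - u * (2 * u)| ≤ u ^ 2 + τ ^ 2 := by
      rw [abs_le]; constructor <;> nlinarith [sq_nonneg u, sq_nonneg τ]
    have h2 : τ ^ 2 ≤ u ^ 2 + τ ^ 2 := by nlinarith [sq_nonneg u]
    calc _ ≤ (u ^ 2 + τ ^ 2) * (u ^ 2 + τ ^ 2) :=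
          mul_le_mul h1 h2 (by positivity) (by positivity)
      _ = 1 * (u ^ 2 + τ ^ 2) ^ 2 := by ring

theorem ibp_main (R : ℝ) (hR : 1 ≤ R) : ∃ C : ℝ, 1 ≤ C ∧
    ∀ (lam : ℝ) (Q : Polynomial ℝ) (χ h H : ℝ → ℝ) (L η τ : ℝ),
    0 ≤ lam → lam ≤ 1 → (∀ t ∈ Icc (0:ℝ) 1, |Q.eval t| ≤ R) →
    (∀ t ∈ Icc (0:ℝ) 1, |Q.derivative.eval t| ≤ R) →
    (∀ t ∈ Icc (0:ℝ) 1, |Q.derivative.derivative.eval t| ≤ R) →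
    ContDiff ℝ 1 χ → (∀ t, |χ t| ≤ 1) → (∀ t, |deriv χ t| ≤ L) → 1 ≤ L →
    (∀ t, t ∉ Icc (0:ℝ) 1 → χ t = 0) →
    ContDiff ℝ 1 h → (∀ t, |h t| ≤ 1) → (∀ t, t ∉ Icc (-1:ℝ) 3 → h t = 0) →
    (∀ t, HasDerivAt H (h t) t) → (∀ t, |H t| ≤ η) → 0 ≤ η → 0 < τ → τ ≤ 1 →
    |∫ z : EE, Psi lam (fun t => Q.eval t) χ h z.1.1 z.1.2 z.2.1 *
        Psi lam (fun t => Q.eval t) χ h z.1.1 z.1.2 z.2.2 *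
      ((Dd lam (fun t => Q.derivative.eval t) z.1.2 z.2.1 z.2.2) ^ 2 /
        ((Dd lam (fun t => Q.derivative.eval t) z.1.2 z.2.1 z.2.2) ^ 2 + τ ^ 2))| ≤ C * (η * L / τ ^ 2) := by
  set r := 2 * R + 1 with hr
  have hr1 : 1 ≤ r := by linarith
  refine ⟨16 * (R + 3) * (6 * r ^ 3 * (36 * r ^ 3 + 16)), ?_, ?_⟩
  · have : 1 ≤ r ^ 3 := one_le_pow₀ hr1
    nlinarith [mul_le_mul this this zero_le_one (by positivity)]
  intro lam Q χ h H L η τ hl0 hl1 hQ0 hQ1 hQ2 hχ hχb hχ' hL hχs hh hhb hhs hH hHb hη hτ hτ1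
  have hr3 : 1 ≤ r ^ 3 := one_le_pow₀ hr1
  set A : EE → ℝ := fun z => Q.derivative.eval z.2.1 with hA
  set A' : EE → ℝ := fun z => Q.derivative.eval (z.2.1 - z.1.2) with hA'
  set B : EE → ℝ := fun z => Q.derivative.eval z.2.2 with hB
  set B' : EE → ℝ := fun z => Q.derivative.eval (z.2.2 - z.1.2) with hB'
  set D : EE → ℝ := fun z => Dd lam (fun t => Q.derivative.eval t) z.1.2 z.2.1 z.2.2 with hD
  have hDeq : ∀ z, D z = A z * A' z * B z - A z * B z * B' z + A' z * B z * B' z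
    - A z * A' z * B' z + (lam * A z * B' z - lam * A' z * B z) := by
    intro z; simp only [hD, Dd, hA, hA', hB, hB']; ring
  have hpc : ∀ P : Polynomial ℝ, ContDiff ℝ 1 (fun t => P.eval t) := fun P => by
    simpa using P.contDiff_aeval (𝕜 := ℝ) 1
  have mk : ∀ F : EE → ℝ, BD F 1 2 → (∀ z ∈ UU, F z ∈ Icc (0:ℝ) 1) →
      BD (fun z => Q.derivative.eval (F z)) r r := by
    intro F hF hz
    refine (hF.comp (hpc Q.derivative) (e0 := R) (e1 := R) (fun z h => ⟨hQ1 _ (hz z h), ?_⟩)).mono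
      (by linarith) (by linarith)
    rw [Polynomial.deriv]; exact hQ2 _ (hz z h)
  have bA : BD A r r := mk _ BD_a (fun z hz => hz.1)
  have bB : BD B r r := mk _ BD_b (fun z hz => hz.2.1)
  have bA' : BD A' r r := mk _ BD_am (fun z hz => hz.2.2.1)
  have bB' : BD B' r r := mk _ BD_bm (fun z hz => hz.2.2.2)
  have bl : BD (fun _ => lam) r r := (BD.const lam).mono (by rw [abs_of_nonneg hl0]; linarith) (by linarith)
  have bo : BD (fun _ => (1:ℝ)) r r := (BD.const 1).mono (by simpa using hr1) (by linarith)
  have bD : BD D (18 * r ^ 3) (18 * r ^ 3) := by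
    have := ((((bA.mul3 bA' bB).sub (bA.mul3 bB bB')).add (bA'.mul3 bB bB')).sub (bA.mul3 bA' bB')).add
      ((bl.mul3 bA bB').sub (bl.mul3 bA' bB))
    rw [show D = _ from funext hDeq]
    exact this.mono (by linarith) (by linarith)
  -- the vector field
  set Vx : EE → ℝ := fun z => A z * B z * A' z - lam * A z * B z with hVx
  set Vm : EE → ℝ := fun z => 1 * B z * A z - 1 * B z * A' z with hVm
  set Va : EE → ℝ := fun z => lam * 1 * B z - 1 * B z * A' z with hVa
  set Vb : EE → ℝ := fun z => lam * 1 * A z - 1 * A z * A' z with hVb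
  have bVx : BD Vx (6 * r ^ 3) (6 * r ^ 3) :=
    ((bA.mul3 bB bA').sub (bl.mul3 bA bB)).mono (by linarith) (by linarith)
  have bVm : BD Vm (6 * r ^ 3) (6 * r ^ 3) :=
    ((bo.mul3 bB bA).sub (bo.mul3 bB bA')).mono (by linarith) (by linarith)
  have bVa : BD Va (6 * r ^ 3) (6 * r ^ 3) :=
    ((bl.mul3 bo bB).sub (bo.mul3 bB bA')).mono (by linarith) (by linarith)
  have bVb : BD Vb (6 * r ^ 3) (6 * r ^ 3) :=
    ((bl.mul3 bo bA).sub (bo.mul3 bA bA')).mono (by linarith) (by linarith)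
  -- the weight
  set X : EE → ℝ := fun z => χ z.2.1 * χ (z.2.1 - z.1.2) * (χ z.2.2 * χ (z.2.2 - z.1.2)) with hX
  have mkχ : ∀ F : EE → ℝ, BD F 1 2 → BD (fun z => χ (F z)) 1 (2 * L) := fun F hF =>
    (hF.comp hχ (fun z _ => ⟨hχb _, hχ' _⟩)).mono le_rfl (by linarith)
  have bX : BD X 1 (8 * L) := by
    have := ((mkχ _ BD_a).mul (mkχ _ BD_am)).mul ((mkχ _ BD_b).mul (mkχ _ BD_bm))
    exact this.mono (by linarith) (by linarith)
  have hX0 : ∀ z, z ∉ UU → X z = 0 := by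
    intro z hz
    by_contra hne
    apply hz
    have n1 : χ z.2.1 ≠ 0 := fun h0 => hne (by simp [hX, h0])
    have n2 : χ (z.2.1 - z.1.2) ≠ 0 := fun h0 => hne (by simp [hX, h0])
    have n3 : χ z.2.2 ≠ 0 := fun h0 => hne (by simp [hX, h0])
    have n4 : χ (z.2.2 - z.1.2) ≠ 0 := fun h0 => hne (by simp [hX, h0])
    exact ⟨by_contra fun h => n1 (hχs _ h), by_contra fun h => n3 (hχs _ h),
      by_contra fun h => n2 (hχs _ h), by_contra fun h => n4 (hχs _ h)⟩
  set Y : EE → ℝ := fun z => D z / (D z ^ 2 + τ ^ 2) with hY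
  have bY : BD Y (1 / τ ^ 2) (1 / τ ^ 2 * (18 * r ^ 3)) :=
    bD.comp (rat_bd hτ hτ1).1 (fun z _ => (rat_bd hτ hτ1).2 _)
  set w : EE → ℝ := fun z => X z * Y z with hw
  have bw : BD w (1 / τ ^ 2 * L) (1 / τ ^ 2 * L * (18 * r ^ 3 + 8)) := by
    have ht : 0 ≤ 1 / τ ^ 2 := by positivity
    refine (bX.mul bY).mono ?_ ?_
    · nlinarith
    · have h1 : 0 ≤ 1 / τ ^ 2 * (18 * r ^ 3) := by positivity
      nlinarith
  set c1 := L / τ ^ 2 * (6 * r ^ 3 * (36 * r ^ 3 + 16)) with hc1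
  have bW : ∀ V : EE → ℝ, BD V (6 * r ^ 3) (6 * r ^ 3) →
      BD (fun z => w z * V z) (1 / τ ^ 2 * L * (6 * r ^ 3)) c1 := by
    intro V hV
    refine (bw.mul hV).mono le_rfl ?_
    have e : c1 = 1 / τ ^ 2 * L * (6 * r ^ 3) + 6 * r ^ 3 * (1 / τ ^ 2 * L * (18 * r ^ 3 + 8)) +
      1 / τ ^ 2 * L * (6 * r ^ 3 * (18 * r ^ 3 + 7)) := by rw [hc1]; ring
    have : 0 ≤ 1 / τ ^ 2 * L * (6 * r ^ 3 * (18 * r ^ 3 + 7)) := by positivity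
    linarith
  have hw0 : ∀ (V : EE → ℝ), ∀ z, z ∉ UU → w z * V z = 0 := fun V z hz => by simp [hw, hX0 z hz]
  -- the function G
  set G : EE → ℝ := fun z => h (z.1.1 + Q.eval z.2.1) * h (z.1.1 + lam * z.1.2 + Q.eval (z.2.1 - z.1.2)) *
    h (z.1.1 + Q.eval z.2.2) * H (z.1.1 + lam * z.1.2 + Q.eval (z.2.2 - z.1.2)) with hG
  have hHc : ContDiff ℝ 1 H := by
    rw [contDiff_one_iff_deriv]
    refine ⟨fun t => (hH t).differentiableAt, ?_⟩
    rw [show deriv H = h from funext fun t => (hH t).deriv]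
    exact hh.continuous
  have hQc : ContDiff ℝ 1 (fun t => Q.eval t) := hpc Q
  have cq1 : ContDiff ℝ 1 (fun z : EE => Q.eval z.2.1) := hQc.comp BD_a.1
  have cq2 : ContDiff ℝ 1 (fun z : EE => Q.eval z.2.2) := hQc.comp BD_b.1
  have cq3 : ContDiff ℝ 1 (fun z : EE => Q.eval (z.2.1 - z.1.2)) := hQc.comp BD_am.1
  have cq4 : ContDiff ℝ 1 (fun z : EE => Q.eval (z.2.2 - z.1.2)) := hQc.comp BD_bm.1
  have cx : ContDiff ℝ 1 (fun z : EE => z.1.1) := contDiff_fst.comp contDiff_fst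
  have cm : ContDiff ℝ 1 (fun z : EE => z.1.2) := contDiff_snd.comp contDiff_fst
  have cxm : ContDiff ℝ 1 (fun z : EE => z.1.1 + lam * z.1.2) := cx.add (contDiff_const.mul cm)
  have cG : ContDiff ℝ 1 G :=
    (((hh.comp (cx.add cq1)).mul (hh.comp (cxm.add cq3))).mul (hh.comp (cx.add cq2))).mul
      (hHc.comp (cxm.add cq4))
  set Cs : Set EE := {z | z.1.1 + Q.eval z.2.1 ∈ Icc (-1:ℝ) 3} with hCs
  have hCc : IsClosed Cs := isClosed_Icc.preimage (cx.add cq1).continuous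
  have hG0 : ∀ z, z ∉ Cs → G z = 0 := fun z hz => by
    have : h (z.1.1 + Q.eval z.2.1) = 0 := hhs _ hz
    simp [hG, this]
  have hGb : ∀ z, |G z| ≤ η := by
    intro z
    simp only [hG, abs_mul]
    have h1 := hhb (z.1.1 + Q.eval z.2.1)
    have h2 := hhb (z.1.1 + lam * z.1.2 + Q.eval (z.2.1 - z.1.2))
    have h3 := hhb (z.1.1 + Q.eval z.2.2)
    have h4 := hHb (z.1.1 + lam * z.1.2 + Q.eval (z.2.2 - z.1.2))
    calc _ ≤ 1 * 1 * 1 * η := by gcongr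
      _ = η := by ring
  have hCU : Cs ∩ UU ⊆ Box (R + 3) := by
    rintro z ⟨h1, h2, h3, h4, h5⟩
    have := abs_le.1 (hQ0 _ h2)
    exact ⟨⟨⟨by linarith [h1.1], by linarith [h1.2]⟩,
      ⟨by linarith [h2.1, h4.2], by linarith [h2.2, h4.1]⟩⟩, h2, h3⟩
  have hfd : ∀ z, fderiv ℝ G z ((Vx z, Vm z), (Va z, Vb z)) =
      D z * (h (z.1.1 + Q.eval z.2.1) * h (z.1.1 + lam * z.1.2 + Q.eval (z.2.1 - z.1.2)) *
    h (z.1.1 + Q.eval z.2.2) * h (z.1.1 + lam * z.1.2 + Q.eval (z.2.2 - z.1.2))) := by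
    intro z
    have hl := ((cG.differentiable (by norm_num)) z).hasFDerivAt.hasLineDerivAt ((Vx z, Vm z), (Va z, Vb z))
    unfold HasLineDerivAt at hl
    have lin : ∀ p v : ℝ, HasDerivAt (fun s : ℝ => p + s * v) v 0 := fun p v => by
      simpa using ((hasDerivAt_id (0:ℝ)).mul_const v).const_add p
    have q1 : ∀ (p v p' v' : ℝ), HasDerivAt (fun s : ℝ => (p + s * v) + Q.eval (p' + s * v'))
        (v + Q.derivative.eval p' * v') 0 := by
      intro p v p' v'
      have h1 := (Q.hasDerivAt (p' + 0 * v')).comp (0:ℝ) (lin p' v')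
      simp only [zero_mul, add_zero] at h1
      exact (lin p v).add h1
    have hc : ∀ (k k' : ℝ → ℝ) (u : ℝ → ℝ) (u' : ℝ), (∀ t, HasDerivAt k (k' t) t) → HasDerivAt u u' 0 →
        HasDerivAt (fun s => k (u s)) (k' (u 0) * u') 0 := fun k k' u u' hk hu => (hk (u 0)).comp 0 hu
    have hhd : ∀ t, HasDerivAt h (deriv h t) t := fun t =>
      ((hh.differentiable (by norm_num)) t).hasDerivAt
    have t1 := hc h _ _ _ hhd (q1 z.1.1 (Vx z) z.2.1 (Va z))
    have t2 := hc h _ _ _ hhd (q1 (z.1.1 + lam * z.1.2) (Vx z + lam * Vm z) (z.2.1 - z.1.2) (Va z - Vm z))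
    have t3 := hc h _ _ _ hhd (q1 z.1.1 (Vx z) z.2.2 (Vb z))
    have t4 := hc H _ _ _ hH (q1 (z.1.1 + lam * z.1.2) (Vx z + lam * Vm z) (z.2.2 - z.1.2) (Vb z - Vm z))
    have v1 : Vx z + Q.derivative.eval z.2.1 * Va z = 0 := by
      simp only [hVx, hVa, hA]; ring
    have v3 : Vx z + Q.derivative.eval z.2.2 * Vb z = 0 := by
      simp only [hVx, hVb, hB]; ring
    have v2 : Vx z + lam * Vm z + Q.derivative.eval (z.2.1 - z.1.2) * (Va z - Vm z) = 0 := by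
      simp only [hVx, hVa, hVm, hA']; ring
    have v4 : Vx z + lam * Vm z + Q.derivative.eval (z.2.2 - z.1.2) * (Vb z - Vm z) = D z := by
      rw [hDeq]; simp only [hVx, hVb, hVm, hB']; ring
    rw [v1, mul_zero] at t1
    rw [v2, mul_zero] at t2
    rw [v3, mul_zero] at t3
    rw [v4] at t4
    have t5 := ((t1.mul t2).mul t3).mul t4
    have heq : (fun t : ℝ => G (z + t • ((Vx z, Vm z), (Va z, Vb z)))) =
      ((((fun s => h (z.1.1 + s * Vx z + Q.eval (z.2.1 + s * Va z))) *
        (fun s => h (z.1.1 + lam * z.1.2 + s * (Vx z + lam * Vm z) + Q.eval (z.2.1 - z.1.2 + s * (Va z - Vm z))))) *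
        (fun s => h (z.1.1 + s * Vx z + Q.eval (z.2.2 + s * Vb z)))) *
        (fun s => H (z.1.1 + lam * z.1.2 + s * (Vx z + lam * Vm z) + Q.eval (z.2.2 - z.1.2 + s * (Vb z - Vm z))))) := by
      funext t
      simp only [hG, Pi.mul_apply, Prod.fst_add, Prod.snd_add, Prod.smul_fst, Prod.smul_snd, smul_eq_mul]
      have e1 : z.2.1 + t * Va z - (z.1.2 + t * Vm z) = z.2.1 - z.1.2 + t * (Va z - Vm z) := by ring
      have e2 : z.2.2 + t * Vb z - (z.1.2 + t * Vm z) = z.2.2 - z.1.2 + t * (Vb z - Vm z) := by ring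
      have e3 : z.1.1 + t * Vx z + lam * (z.1.2 + t * Vm z) =
        z.1.1 + lam * z.1.2 + t * (Vx z + lam * Vm z) := by ring
      rw [e1, e2, e3]
    rw [heq] at hl
    have := hl.unique t5
    rw [this]
    simp only [zero_mul, add_zero, mul_zero, zero_add, Pi.mul_apply]
    ring
  -- integrate by parts in the four directions
  have hK : (0:ℝ) ≤ R + 3 := by linarith
  have I := fun (V : EE → ℝ) (hV : BD V (6 * r ^ 3) (6 * r ^ 3)) (e : EE) (he : ‖e‖ ≤ 1) =>
    ibp_one hK hη (bW V hV) (hw0 V) cG hCc hG0 hGb hCU e he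
  have Ix := I Vx bVx ((1, 0), (0, 0)) (by simp [Prod.norm_def])
  have Im := I Vm bVm ((0, 1), (0, 0)) (by simp [Prod.norm_def])
  have Ia := I Va bVa ((0, 0), (1, 0)) (by simp [Prod.norm_def])
  have Ib := I Vb bVb ((0, 0), (0, 1)) (by simp [Prod.norm_def])
  have hintg : ∀ z : EE, Psi lam (fun t => Q.eval t) χ h z.1.1 z.1.2 z.2.1 *
        Psi lam (fun t => Q.eval t) χ h z.1.1 z.1.2 z.2.2 * (D z ^ 2 / (D z ^ 2 + τ ^ 2)) =
      (w z * Vx z * fderiv ℝ G z ((1, 0), (0, 0)) + w z * Vm z * fderiv ℝ G z ((0, 1), (0, 0))) +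
      (w z * Va z * fderiv ℝ G z ((0, 0), (1, 0)) + w z * Vb z * fderiv ℝ G z ((0, 0), (0, 1))) := by
    intro z
    have hdec : (((Vx z, Vm z), (Va z, Vb z)) : EE) = Vx z • ((1, 0), (0, 0)) + Vm z • ((0, 1), (0, 0)) +
      Va z • ((0, 0), (1, 0)) + Vb z • ((0, 0), (0, 1)) := by simp
    have h1 := hfd z
    rw [hdec, map_add, map_add, map_add, map_smul, map_smul, map_smul, map_smul] at h1
    simp only [smul_eq_mul] at h1
    have h2 : (w z * Vx z * fderiv ℝ G z ((1, 0), (0, 0)) + w z * Vm z * fderiv ℝ G z ((0, 1), (0, 0))) +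
      (w z * Va z * fderiv ℝ G z ((0, 0), (1, 0)) + w z * Vb z * fderiv ℝ G z ((0, 0), (0, 1))) =
      w z * (Vx z * fderiv ℝ G z ((1, 0), (0, 0)) + Vm z * fderiv ℝ G z ((0, 1), (0, 0)) +
      Va z * fderiv ℝ G z ((0, 0), (1, 0)) + Vb z * fderiv ℝ G z ((0, 0), (0, 1))) := by ring
    rw [h2, h1]
    simp only [hw, hX, hY, Psi]
    ring
  have hfin : ∀ z : EE, Dd lam (fun t => Q.derivative.eval t) z.1.2 z.2.1 z.2.2 = D z := fun z => rfl
  simp only [hfin, hintg]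
  have ixm : Integrable (fun z => w z * Vx z * fderiv ℝ G z ((1, 0), (0, 0)) +
    w z * Vm z * fderiv ℝ G z ((0, 1), (0, 0))) := Ix.1.add Im.1
  have iab : Integrable (fun z => w z * Va z * fderiv ℝ G z ((0, 0), (1, 0)) +
    w z * Vb z * fderiv ℝ G z ((0, 0), (0, 1))) := Ia.1.add Ib.1
  rw [integral_add ixm iab, integral_add Ix.1 Im.1, integral_add Ia.1 Ib.1]
  have hfinal : 16 * (R + 3) * (6 * r ^ 3 * (36 * r ^ 3 + 16)) * (η * L / τ ^ 2) =
      4 * (4 * (R + 3) * (c1 * η)) := by rw [hc1]; ring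
  rw [hfinal]
  have := abs_add_le ((∫ z, w z * Vx z * fderiv ℝ G z ((1, 0), (0, 0))) +
    ∫ z, w z * Vm z * fderiv ℝ G z ((0, 1), (0, 0))) ((∫ z, w z * Va z * fderiv ℝ G z ((0, 0), (1, 0))) +
    ∫ z, w z * Vb z * fderiv ℝ G z ((0, 0), (0, 1)))
  have t1 := abs_add_le (∫ z, w z * Vx z * fderiv ℝ G z ((1, 0), (0, 0)))
    (∫ z, w z * Vm z * fderiv ℝ G z ((0, 1), (0, 0)))
  have t2 := abs_add_le (∫ z, w z * Va z * fderiv ℝ G z ((0, 0), (1, 0)))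
    (∫ z, w z * Vb z * fderiv ℝ G z ((0, 0), (0, 1)))
  linarith [Ix.2, Im.2, Ia.2, Ib.2]

end PR

namespace PR

theorem mp_shearq {q : ℝ → ℝ} (hq : Measurable q) :
    MeasurePreserving (fun p : ℝ × ℝ => (p.1 + q p.2, p.2))
      (volume : Measure (ℝ × ℝ)) (volume : Measure (ℝ × ℝ)) := by
  have h1 : MeasurePreserving (fun p : ℝ × ℝ => (p.1, p.2 + q p.1)) (volume.prod volume)
      (volume.prod volume) :=
    (MeasurePreserving.id volume).skew_product (g := fun t x => x + q t) (by fun_prop)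
      (Filter.Eventually.of_forall fun t => (measurePreserving_add_right volume (q t)).map_eq)
  have h2 := (Measure.measurePreserving_swap (μ := (volume : Measure ℝ)) (ν := (volume : Measure ℝ)))
  exact (h2.comp h1).comp h2

theorem Lam_intble {lam : ℝ} {q χ f g h : ℝ → ℝ} (hq : Measurable q) (hχ : Measurable χ)
    (hf : Measurable f) (hg : Measurable g) (hh : Measurable h)
    (hfb : ∀ t, |f t| ≤ 1) (hgb : ∀ t, |g t| ≤ 1)
    (hχi : Integrable χ) (hhi : Integrable h) :
    Integrable (fun p : ℝ × ℝ => f p.1 * g (p.1 + lam * p.2) * h (p.1 + q p.2) * χ p.2) ∧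
    |Lam lam q χ f g h| ≤ (∫ t, |h t|) * ∫ t, |χ t| := by
  have i0 : Integrable (fun p : ℝ × ℝ => |h p.1| * |χ p.2|) := hhi.abs.mul_prod hχi.abs
  have i1 : Integrable (fun p : ℝ × ℝ => |h (p.1 + q p.2)| * |χ p.2|) :=
    (mp_shearq hq).integrable_comp_of_integrable i0
  have hb : ∀ p : ℝ × ℝ, ‖f p.1 * g (p.1 + lam * p.2) * h (p.1 + q p.2) * χ p.2‖ ≤
      |h (p.1 + q p.2)| * |χ p.2| := by
    intro p
    rw [Real.norm_eq_abs, abs_mul, abs_mul, abs_mul]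
    have h1 := hfb p.1
    have h2 := hgb (p.1 + lam * p.2)
    calc |f p.1| * |g (p.1 + lam * p.2)| * |h (p.1 + q p.2)| * |χ p.2|
        ≤ 1 * 1 * |h (p.1 + q p.2)| * |χ p.2| := by gcongr
      _ = _ := by ring
  have hm : Measurable (fun p : ℝ × ℝ => f p.1 * g (p.1 + lam * p.2) * h (p.1 + q p.2) * χ p.2) := by
    fun_prop
  refine ⟨i1.mono' hm.aestronglyMeasurable (Filter.Eventually.of_forall hb), ?_⟩
  have h1 := norm_integral_le_of_norm_le i1 (Filter.Eventually.of_forall hb)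
  rw [Real.norm_eq_abs] at h1
  refine h1.trans (le_of_eq ?_)
  have h2 := mp_integral (mp_shearq hq) (F := fun p : ℝ × ℝ => |h p.1| * |χ p.2|) (by fun_prop)
  simp only at h2
  rw [h2]
  exact integral_prod_mul (fun t => |h t|) (fun t => |χ t|)

theorem Lam_sub {lam : ℝ} {q χ f g h k : ℝ → ℝ} (hq : Measurable q) (hχ : Measurable χ)
    (hf : Measurable f) (hg : Measurable g) (hh : Measurable h) (hk : Measurable k)
    (hfb : ∀ t, |f t| ≤ 1) (hgb : ∀ t, |g t| ≤ 1)
    (hχi : Integrable χ) (hhi : Integrable h) (hki : Integrable k) :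
    Lam lam q χ f g (fun t => h t - k t) = Lam lam q χ f g h - Lam lam q χ f g k := by
  unfold Lam
  rw [← integral_sub (Lam_intble hq hχ hf hg hh hfb hgb hχi hhi).1
    (Lam_intble hq hχ hf hg hk hfb hgb hχi hki).1]
  congr 1
  funext p
  ring

theorem propA_smooth (R : ℝ) (hR : 1 ≤ R) (d : ℕ) (hd : 1 < d) : ∃ C : ℝ, 1 ≤ C ∧
    ∀ (lam : ℝ) (Q : Polynomial ℝ) (χ f g h H : ℝ → ℝ) (L η σ : ℝ),
    Q.Monic → Q.natDegree = d →
    0 ≤ lam → lam ≤ 1 → (∀ t ∈ Icc (0:ℝ) 1, |Q.eval t| ≤ R) →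
    (∀ t ∈ Icc (0:ℝ) 1, |Q.derivative.eval t| ≤ R) →
    (∀ t ∈ Icc (0:ℝ) 1, |Q.derivative.derivative.eval t| ≤ R) →
    ContDiff ℝ 1 χ → (∀ t, |χ t| ≤ 1) → (∀ t, |deriv χ t| ≤ L) → 1 ≤ L →
    (∀ t, t ∉ Icc (0:ℝ) 1 → χ t = 0) →
    Measurable f → (∀ t, |f t| ≤ 1) → (∀ t, t ∉ Icc (0:ℝ) 2 → f t = 0) →
    Measurable g → (∀ t, |g t| ≤ 1) →
    ContDiff ℝ 1 h → (∀ t, |h t| ≤ 1) → (∀ t, t ∉ Icc (-1:ℝ) 3 → h t = 0) →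
    (∀ t, HasDerivAt H (h t) t) → (∀ t, |H t| ≤ η) → 0 ≤ η → 0 < σ → σ ≤ 1 →
    (Lam lam (fun t => Q.eval t) χ f g h) ^ 4 ≤ C * (η * L / (σ ^ (6 * (d - 1))) ^ 2 + σ) := by
  obtain ⟨C, hC1, hC⟩ := ibp_main R hR
  refine ⟨36 * C + 36 * (40 * d * (R + 3)), ?_, ?_⟩
  · have : 0 ≤ 36 * (40 * (d:ℝ) * (R + 3)) := by positivity
    linarith
  intro lam Q χ f g h H L η σ hQm hQd hl0 hl1 hQ0 hQ1 hQ2 hχ hχb hχ' hL hχs hf hfb hfs hg hgb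
    hh hhb hhs hH hHb hη hσ hσ1
  set τ := σ ^ (6 * (d - 1)) with hτ
  have hτ0 : 0 < τ := by positivity
  have hτ1 : τ ≤ 1 := pow_le_one₀ hσ.le hσ1
  have hqm : Measurable (fun t => Q.eval t) := Q.continuous.measurable
  have h1 := cs_twice hl0 hl1 hqm hQ0 hχ.continuous.measurable hf hg hh.continuous.measurable
    hχb hfb hgb hhb hχs hfs hhs
  have h2 := hC lam Q χ h H L η τ hl0 hl1 hQ0 hQ1 hQ2 hχ hχb hχ' hL hχs hh hhb hhs hH hHb hη hτ0 hτ1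
  set F : EE → ℝ := fun z => Psi lam (fun t => Q.eval t) χ h z.1.1 z.1.2 z.2.1 *
    Psi lam (fun t => Q.eval t) χ h z.1.1 z.1.2 z.2.2 with hF
  have hK : (0:ℝ) ≤ R + 3 := by linarith
  have hF0 : ∀ z, z ∉ Box (R + 3) → F z = 0 := by
    intro z hz
    by_contra hne
    apply hz
    have n1 : χ z.2.1 ≠ 0 := fun h0 => hne (by simp [hF, Psi, h0])
    have n2 : χ (z.2.1 - z.1.2) ≠ 0 := fun h0 => hne (by simp [hF, Psi, h0])
    have n3 : χ z.2.2 ≠ 0 := fun h0 => hne (by simp [hF, Psi, h0])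
    have n5 : h (z.1.1 + Q.eval z.2.1) ≠ 0 := fun h0 => hne (by simp [hF, Psi, h0])
    have m1 : z.2.1 ∈ Icc (0:ℝ) 1 := by_contra fun h => n1 (hχs _ h)
    have m2 : z.2.1 - z.1.2 ∈ Icc (0:ℝ) 1 := by_contra fun h => n2 (hχs _ h)
    have m3 : z.2.2 ∈ Icc (0:ℝ) 1 := by_contra fun h => n3 (hχs _ h)
    have m5 : z.1.1 + Q.eval z.2.1 ∈ Icc (-1:ℝ) 3 := by_contra fun h => n5 (hhs _ h)
    have := abs_le.1 (hQ0 _ m1)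
    exact ⟨⟨⟨by linarith [m5.1], by linarith [m5.2]⟩,
      ⟨by linarith [m1.1, m2.2], by linarith [m1.2, m2.1]⟩⟩, m1, m3⟩
  have m1 : ∀ {a b : ℝ}, |a| ≤ 1 → |b| ≤ 1 → |a * b| ≤ 1 := by
    intro a b ha hb
    rw [abs_mul]; exact mul_le_one₀ ha (abs_nonneg _) hb
  have hFb : ∀ z, |F z| ≤ 1 := fun z =>
    m1 (m1 (m1 (m1 (hhb _) (hhb _)) (hχb _)) (hχb _)) (m1 (m1 (m1 (hhb _) (hhb _)) (hχb _)) (hχb _))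
  have h3 := Dd_int lam Q d hd hQm hQd hσ hσ1 hK hF0 hFb
  set D : EE → ℝ := fun z => Dd lam (fun t => Q.derivative.eval t) z.1.2 z.2.1 z.2.2 with hD
  have hDc : Continuous D := by
    simp only [hD]; unfold Dd; fun_prop
  have hFm : Continuous F := by
    have := hh.continuous
    have := hχ.continuous
    simp only [hF]; unfold Psi; fun_prop
  have hBf : volume (Box (R + 3)) < ⊤ := by rw [Box_vol hK]; exact ENNReal.ofReal_lt_top
  have hpos : ∀ z, 0 < D z ^ 2 + τ ^ 2 := fun z => by positivity
  have i1 : Integrable (fun z => F z * (D z ^ 2 / (D z ^ 2 + τ ^ 2))) := by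
    refine bdd_integrable (C := 1) hBf ?_ ?_ (fun z hz => by rw [hF0 z hz, zero_mul])
    · have : Continuous (fun z => F z * (D z ^ 2 / (D z ^ 2 + τ ^ 2))) := by
        refine hFm.mul (Continuous.div (by fun_prop) (by fun_prop) (fun z => (hpos z).ne'))
      exact this.measurable
    · intro z
      refine m1 (hFb z) ?_
      rw [abs_of_nonneg (div_nonneg (sq_nonneg _) (hpos z).le), div_le_one (hpos z)]
      nlinarith [sq_nonneg τ]
  have i2 : Integrable (fun z => F z * (τ ^ 2 / (D z ^ 2 + τ ^ 2))) := by
    refine bdd_integrable (C := 1) hBf ?_ ?_ (fun z hz => by rw [hF0 z hz, zero_mul])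
    · have : Continuous (fun z => F z * (τ ^ 2 / (D z ^ 2 + τ ^ 2))) := by
        refine hFm.mul (Continuous.div (by fun_prop) (by fun_prop) (fun z => (hpos z).ne'))
      exact this.measurable
    · intro z
      refine m1 (hFb z) ?_
      rw [abs_of_nonneg (div_nonneg (sq_nonneg _) (hpos z).le), div_le_one (hpos z)]
      nlinarith [sq_nonneg (D z)]
  have hsplit : ∫ z, F z = (∫ z, F z * (D z ^ 2 / (D z ^ 2 + τ ^ 2))) +
      ∫ z, F z * (τ ^ 2 / (D z ^ 2 + τ ^ 2)) := by
    rw [← integral_add i1 i2]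
    congr 1
    funext z
    rw [← mul_add, ← add_div, div_self (hpos z).ne', mul_one]
  have h1' : (Lam lam (fun t => Q.eval t) χ f g h) ^ 4 ≤ 36 * ∫ z, F z := h1
  rw [hsplit] at h1'
  have a1 := (le_abs_self _).trans h2
  have a2 := (le_abs_self _).trans h3
  have p1 : 0 ≤ η * L / τ ^ 2 := by positivity
  have p2 : 0 ≤ 40 * (d:ℝ) * (R + 3) := by positivity
  have p3 : 0 ≤ 40 * (d:ℝ) * (R + 3) * (η * L / τ ^ 2) := mul_nonneg p2 p1
  have p4 : 0 ≤ C * σ := by positivity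
  calc _ ≤ _ := h1'
    _ ≤ 36 * (C * (η * L / τ ^ 2) + 40 * d * (R + 3) * σ) := by
      refine mul_le_mul_of_nonneg_left (add_le_add a1 a2) (by norm_num)
    _ ≤ _ := by linarith

open scoped Convolution in
theorem mollify {h : ℝ → ℝ} (hm : Measurable h) (hb : ∀ t, |h t| ≤ 1)
    (hs : ∀ t, t ∉ Icc (0:ℝ) 2 → h t = 0) {e : ℝ} (he : 0 < e) :
    ∃ k : ℝ → ℝ, ContDiff ℝ 1 k ∧ (∀ t, |k t| ≤ 1) ∧ (∀ t, t ∉ Icc (-1:ℝ) 3 → k t = 0) ∧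
      ∫ t, |h t - k t| ≤ e := by
  have hi : Integrable h := bdd_integrable (B := Icc (0:ℝ) 2) (by simp) hm hb hs
  set φ : ℕ → ContDiffBump (0:ℝ) := fun n =>
    ⟨1 / ((n:ℝ) + 1) / 2, 1 / ((n:ℝ) + 1), by positivity, half_lt_self (by positivity)⟩ with hφ
  set k : ℕ → ℝ → ℝ := fun n => (φ n).normed volume ⋆[ContinuousLinearMap.lsmul ℝ ℝ, volume] h with hk
  have hr : ∀ n, (φ n).rOut = 1 / ((n:ℝ) + 1) := fun n => rfl
  have hr1 : ∀ n, (φ n).rOut ≤ 1 := fun n => by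
    rw [hr, div_le_one (by positivity)]
    have : (0:ℝ) ≤ n := by positivity
    linarith
  have hk1 : ∀ n, ContDiff ℝ 1 (k n) := fun n =>
    HasCompactSupport.contDiff_convolution_left _ (φ n).hasCompactSupport_normed
      (φ n).contDiff_normed hi.locallyIntegrable
  have hk2 : ∀ n t, |k n t| ≤ 1 := by
    intro n t
    have := dist_convolution_le (μ := (volume : Measure ℝ)) (f := (φ n).normed volume) (g := h) (x₀ := t) (z₀ := 0)
      (ε := 1) zero_le_one
      (φ n).support_normed_eq.subset (φ n).nonneg_normed (φ n).integral_normed hm.aestronglyMeasurable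
      (fun x _ => by simpa using hb x)
    simpa using this
  have hk3 : ∀ n t, t ∉ Icc (-1:ℝ) 3 → k n t = 0 := by
    intro n t ht
    have h0 : ∀ x ∈ Metric.ball t (φ n).rOut, h x = 0 := by
      intro x hx
      apply hs
      intro hx2
      apply ht
      rw [Metric.mem_ball, Real.dist_eq, abs_lt] at hx
      exact ⟨by linarith [hr1 n, hx2.1, hx.1, hx.2], by linarith [hr1 n, hx2.2, hx.1, hx.2]⟩
    have ht0 : h t = 0 := h0 t (Metric.mem_ball_self (φ n).rOut_pos)
    have := ContDiffBump.normed_convolution_eq_right (φ := φ n) (μ := (volume : Measure ℝ)) (g := h) (x₀ := t)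
      (fun x hx => by rw [h0 x hx, ht0])
    simp only [hk]
    rw [this, ht0]
  have hlim := ContDiffBump.ae_convolution_tendsto_right_of_locallyIntegrable (φ := φ)
    (l := Filter.atTop) (K := 2) (μ := (volume : Measure ℝ)) (g := h)
    (by simp only [hr]; exact tendsto_one_div_add_atTop_nhds_zero_nat)
    (Filter.Eventually.of_forall fun n => by
      show 1 / ((n:ℝ) + 1) ≤ 2 * (1 / ((n:ℝ) + 1) / 2)
      linarith) hi.locallyIntegrable
  have hdom : Filter.Tendsto (fun n => ∫ t, |h t - k n t|) Filter.atTop (nhds (∫ t : ℝ, (0:ℝ))) := by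
    refine tendsto_integral_of_dominated_convergence ((Icc (-1:ℝ) 3).indicator fun _ => 2) ?_ ?_ ?_ ?_
    · intro n
      have := (hk1 n).continuous.measurable
      exact (by fun_prop : Measurable fun t => |h t - k n t|).aestronglyMeasurable
    · exact (integrable_indicator_iff measurableSet_Icc).2 (integrableOn_const (by simp))
    · intro n
      refine Filter.Eventually.of_forall fun t => ?_
      by_cases ht : t ∈ Icc (-1:ℝ) 3
      · simp only [ht, indicator_of_mem, Real.norm_eq_abs, abs_abs]
        exact (abs_sub _ _).trans (by linarith [hb t, hk2 n t])
      · have : h t = 0 := hs t (fun h2 => ht ⟨by linarith [h2.1], by linarith [h2.2]⟩)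
        simp [ht, this, hk3 n t ht]
    · filter_upwards [hlim] with t ht
      have := (tendsto_const_nhds (x := h t)).sub ht
      simpa using this.abs
  rw [integral_zero] at hdom
  obtain ⟨n, hn⟩ := (hdom.eventually (gt_mem_nhds he)).exists
  exact ⟨k n, hk1 n, hk2 n, hk3 n, hn.le⟩

theorem propA (R : ℝ) (hR : 1 ≤ R) (d : ℕ) (hd : 1 < d) : ∃ C : ℝ, 1 ≤ C ∧
    ∀ (lam : ℝ) (Q : Polynomial ℝ) (χ f g h : ℝ → ℝ) (L η σ X : ℝ),
    Q.Monic → Q.natDegree = d →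
    0 ≤ lam → lam ≤ 1 → (∀ t ∈ Icc (0:ℝ) 1, |Q.eval t| ≤ R) →
    (∀ t ∈ Icc (0:ℝ) 1, |Q.derivative.eval t| ≤ R) →
    (∀ t ∈ Icc (0:ℝ) 1, |Q.derivative.derivative.eval t| ≤ R) →
    ContDiff ℝ 1 χ → (∀ t, |χ t| ≤ 1) → (∀ t, |deriv χ t| ≤ L) → 1 ≤ L →
    (∀ t, t ∉ Icc (0:ℝ) 1 → χ t = 0) →
    Measurable f → (∀ t, |f t| ≤ 1) → (∀ t, t ∉ Icc (0:ℝ) 2 → f t = 0) →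
    Measurable g → (∀ t, |g t| ≤ 1) →
    Measurable h → (∀ t, |h t| ≤ 1) → (∀ t, t ∉ Icc (0:ℝ) 2 → h t = 0) →
    (∀ y, |∫ t in (0:ℝ)..y, h t| ≤ η) → 0 < η → 0 < σ → σ ≤ 1 → 0 ≤ X →
    C * (η * L / (σ ^ (6 * (d - 1))) ^ 2 + σ) ≤ X ^ 4 →
    |Lam lam (fun t => Q.eval t) χ f g h| ≤ X := by
  obtain ⟨C, hC1, hC⟩ := propA_smooth R hR d hd
  refine ⟨2 * C, by linarith, ?_⟩
  intro lam Q χ f g h L η σ X hQm hQd hl0 hl1 hQ0 hQ1 hQ2 hχ hχb hχ' hL hχs hf hfb hfs hg hgb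
    hh hhb hhs hH hη hσ hσ1 hX hCX
  refine le_of_forall_pos_le_add fun e he => ?_
  obtain ⟨k, hk1, hk2, hk3, hk4⟩ := mollify hh hhb hhs (lt_min he hη)
  have hke : ∫ t, |h t - k t| ≤ e := hk4.trans (min_le_left _ _)
  have hkη : ∫ t, |h t - k t| ≤ η := hk4.trans (min_le_right _ _)
  have hi : Integrable h := bdd_integrable (B := Icc (0:ℝ) 2) (by simp) hh hhb hhs
  have ki : Integrable k := bdd_integrable (B := Icc (-1:ℝ) 3) (by simp) hk1.continuous.measurable hk2 hk3
  have χi : Integrable χ := bdd_integrable (B := Icc (0:ℝ) 1) (by simp) hχ.continuous.measurable hχb hχs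
  have hχ1 : ∫ t, |χ t| ≤ 1 := by
    have : ∫ t, |χ t| ≤ ∫ t, (Icc (0:ℝ) 1).indicator (fun _ => (1:ℝ)) t := by
      refine integral_mono χi.abs ((integrable_indicator_iff measurableSet_Icc).2
        (integrableOn_const (by simp))) fun t => ?_
      by_cases ht : t ∈ Icc (0:ℝ) 1
      · simpa [ht] using hχb t
      · simp [ht, hχs t ht]
    rw [integral_indicator_const _ measurableSet_Icc] at this
    simpa using this
  have hqm : Measurable (fun t => Q.eval t) := Q.continuous.measurable
  have hd1 : |Lam lam (fun t => Q.eval t) χ f g h - Lam lam (fun t => Q.eval t) χ f g k| ≤ e := by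
    have km := hk1.continuous.measurable
    rw [← Lam_sub hqm hχ.continuous.measurable hf hg hh hk1.continuous.measurable hfb hgb χi hi ki]
    refine (Lam_intble hqm hχ.continuous.measurable hf hg (hh.sub km) hfb hgb χi (hi.sub ki)).2.trans ?_
    calc _ ≤ e * 1 := mul_le_mul hke hχ1 (integral_nonneg fun _ => abs_nonneg _) he.le
      _ = e := mul_one e
  have hH' : ∀ y, |∫ t in (0:ℝ)..y, k t| ≤ 2 * η := by
    intro y
    have e1 : ∫ t in (0:ℝ)..y, k t = (∫ t in (0:ℝ)..y, h t) - ∫ t in (0:ℝ)..y, (h t - k t) := by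
      rw [intervalIntegral.integral_sub hi.intervalIntegrable ki.intervalIntegrable]; ring
    have e2 : |∫ t in (0:ℝ)..y, (h t - k t)| ≤ η := by
      refine le_trans ?_ hkη
      refine (intervalIntegral.norm_integral_le_integral_norm_uIoc (f := fun t => h t - k t)).trans ?_
      exact setIntegral_le_integral (hi.sub ki).abs (Filter.Eventually.of_forall fun _ => abs_nonneg _)
    rw [e1]
    exact (abs_sub _ _).trans (by linarith [hH y])
  have hmain := hC lam Q χ f g k (fun y => ∫ t in (0:ℝ)..y, k t) L (2 * η) σ hQm hQd hl0 hl1 hQ0 hQ1 hQ2 hχ hχb hχ' hL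
    hχs hf hfb hfs hg hgb hk1 hk2 hk3
    (fun t => intervalIntegral.integral_hasDerivAt_right ki.intervalIntegrable
      (hk1.continuous.stronglyMeasurableAtFilter _ _) hk1.continuous.continuousAt)
    hH' (by linarith) hσ hσ1
  have h4 : (Lam lam (fun t => Q.eval t) χ f g k) ^ 4 ≤ X ^ 4 := by
    refine hmain.trans (le_trans ?_ hCX)
    have : 0 ≤ C * σ := by positivity
    have e3 : 2 * η * L / (σ ^ (6 * (d - 1))) ^ 2 = 2 * (η * L / (σ ^ (6 * (d - 1))) ^ 2) := by ring
    rw [e3]; linarith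
  have h5 : |Lam lam (fun t => Q.eval t) χ f g k| ≤ X := by
    rw [← Even.pow_abs (by decide : Even 4)] at h4
    exact le_of_pow_le_pow_left₀ (by norm_num) hX h4
  have := abs_sub_abs_le_abs_sub (Lam lam (fun t => Q.eval t) χ f g h) (Lam lam (fun t => Q.eval t) χ f g k)
  linarith

end PR

namespace PR

structure Nice (f : ℝ → ℝ) : Prop where
  meas : Measurable f
  nonneg : ∀ x, 0 ≤ f x
  le_one : ∀ x, f x ≤ 1
  zero : ∀ x, x ∉ Ico (0:ℝ) 1 → f x = 0

theorem Nice.abs_le {f : ℝ → ℝ} (hf : Nice f) (x : ℝ) : |f x| ≤ 1 := by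
  rw [abs_of_nonneg (hf.nonneg x)]; exact hf.le_one x

theorem Nice.intble {f : ℝ → ℝ} (hf : Nice f) : Integrable f :=
  bdd_integrable (B := Ico (0:ℝ) 1) (by simp) hf.meas hf.abs_le hf.zero

theorem Nice.mul_intble {f g : ℝ → ℝ} (hf : Nice f) (hg : Measurable g) {C : ℝ} (hgb : ∀ x, |g x| ≤ C) :
    Integrable (fun x => g x * f x) :=
  hf.intble.bdd_mul (c := C) hg.aestronglyMeasurable (Filter.Eventually.of_forall hgb)

theorem Nice.mul {f g : ℝ → ℝ} (hf : Nice f) (hg : Nice g) : Nice (fun x => f x * g x) :=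
  ⟨hf.meas.mul hg.meas, fun x => mul_nonneg (hf.nonneg x) (hg.nonneg x),
    fun x => mul_le_one₀ (hf.le_one x) (hg.nonneg x) (hg.le_one x), fun x hx => by simp [hf.zero x hx]⟩

noncomputable def cell (k : ℕ) (x : ℝ) : ℤ := ⌊(2:ℝ) ^ k * x⌋

noncomputable def same (k : ℕ) (x y : ℝ) : ℝ := if cell k x = cell k y then 1 else 0

noncomputable def E (k : ℕ) (f : ℝ → ℝ) (x : ℝ) : ℝ := 2 ^ k * ∫ y, same k x y * f y

theorem cell_meas (k : ℕ) : Measurable (cell k) :=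
  Int.measurable_floor.comp (by fun_prop)

theorem same_meas (k : ℕ) : Measurable (fun p : ℝ × ℝ => same k p.1 p.2) := by
  unfold same
  refine Measurable.ite ?_ measurable_const measurable_const
  exact measurableSet_eq_fun ((cell_meas k).comp measurable_fst) ((cell_meas k).comp measurable_snd)

theorem same_nonneg (k : ℕ) (x y : ℝ) : 0 ≤ same k x y := by unfold same; split_ifs <;> norm_num
theorem same_le_one (k : ℕ) (x y : ℝ) : same k x y ≤ 1 := by unfold same; split_ifs <;> norm_num
theorem same_symm (k : ℕ) (x y : ℝ) : same k x y = same k y x := by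
  unfold same; simp only [eq_comm]
theorem same_abs (k : ℕ) (x y : ℝ) : |same k x y| ≤ 1 := by
  rw [abs_of_nonneg (same_nonneg k x y)]; exact same_le_one k x y

theorem cell_mem (k : ℕ) (x : ℝ) : x ∈ Ico (0:ℝ) 1 ↔ cell k x ∈ Ico (0:ℤ) (2 ^ k) := by
  have h2 : (0:ℝ) < 2 ^ k := by positivity
  unfold cell
  constructor
  · rintro ⟨h0, h1⟩
    refine ⟨Int.floor_nonneg.2 (by positivity), Int.floor_lt.2 ?_⟩
    push_cast; nlinarith
  · rintro ⟨h0, h1⟩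
    rw [Int.floor_nonneg] at h0
    rw [Int.floor_lt] at h1
    push_cast at h1
    exact ⟨nonneg_of_mul_nonneg_right h0 h2, by nlinarith⟩

theorem cell_eq_mem {k : ℕ} {x y : ℝ} (h : cell k x = cell k y) (hx : x ∈ Ico (0:ℝ) 1) : y ∈ Ico (0:ℝ) 1 := by
  rw [cell_mem k] at hx ⊢; rwa [← h]

theorem same_eq_indicator (k : ℕ) (x : ℝ) : (fun y => same k x y) =
    (Ico ((cell k x : ℝ) / 2 ^ k) ((cell k x + 1 : ℝ) / 2 ^ k)).indicator fun _ => 1 := by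
  funext y
  have h2 : (0:ℝ) < 2 ^ k := by positivity
  have : cell k x = cell k y ↔ y ∈ Ico ((cell k x : ℝ) / 2 ^ k) ((cell k x + 1 : ℝ) / 2 ^ k) := by
    rw [eq_comm]
    conv_lhs => rw [cell, Int.floor_eq_iff]
    rw [mem_Ico, div_le_iff₀ h2, lt_div_iff₀ h2, mul_comm]
  unfold same indicator
  simp only [this]

theorem same_int (k : ℕ) (x : ℝ) : ∫ y, same k x y = 1 / 2 ^ k := by
  have h2 : (0:ℝ) < 2 ^ k := by positivity
  rw [same_eq_indicator, integral_indicator_const _ measurableSet_Ico, Measure.real, Real.volume_Ico,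
    ENNReal.toReal_ofReal]
  · simp; field_simp; ring
  · rw [← sub_div]; simp

theorem same_intble (k : ℕ) (x : ℝ) : Integrable (fun y => same k x y) := by
  rw [same_eq_indicator]
  exact (integrable_indicator_iff measurableSet_Ico).2 (integrableOn_const (by simp))

theorem same_f_meas {k : ℕ} {f : ℝ → ℝ} (hf : Measurable f) :
    Measurable (fun p : ℝ × ℝ => same k p.1 p.2 * f p.2) :=
  (same_meas k).mul (hf.comp measurable_snd)

theorem same_f_intble {k : ℕ} {f : ℝ → ℝ} (hf : Nice f) (x : ℝ) : Integrable (fun y => same k x y * f y) :=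
  hf.mul_intble ((same_meas k).comp (measurable_const.prodMk measurable_id)) (same_abs k x)

def CC (k : ℕ) (g : ℝ → ℝ) : Prop := ∀ x y, cell k x = cell k y → g x = g y

theorem E_CC (k : ℕ) (f : ℝ → ℝ) : CC k (E k f) := by
  intro x y h
  unfold E same
  rw [h]

theorem E_nice {f : ℝ → ℝ} (hf : Nice f) (k : ℕ) : Nice (E k f) := by
  have h2 : (0:ℝ) < 2 ^ k := by positivity
  refine ⟨?_, ?_, ?_, ?_⟩
  · unfold E
    exact measurable_const.mul (same_f_meas hf.meas).stronglyMeasurable.integral_prod_right.measurable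
  · intro x
    exact mul_nonneg h2.le (integral_nonneg fun y => mul_nonneg (same_nonneg _ _ _) (hf.nonneg y))
  · intro x
    have : ∫ y, same k x y * f y ≤ ∫ y, same k x y :=
      integral_mono (same_f_intble hf x) (same_intble k x)
        (fun y => mul_le_of_le_one_right (same_nonneg _ _ _) (hf.le_one y))
    rw [same_int, le_div_iff₀ h2] at this
    unfold E; linarith
  · intro x hx
    unfold E
    have : ∀ y, same k x y * f y = 0 := by
      intro y
      unfold same
      split_ifs with h
      · rw [hf.zero y (fun hy => hx (cell_eq_mem h.symm hy)), mul_zero]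
      · simp
    simp [this]

theorem key {f g : ℝ → ℝ} (hf : Nice f) (k : ℕ) {C : ℝ} (hg : Measurable g) (hgb : ∀ x, |g x| ≤ C)
    (hcc : CC k g) : ∫ x, g x * E k f x = ∫ x, g x * f x := by
  have h2 : (0:ℝ) < 2 ^ k := by positivity
  have hC : 0 ≤ C := (abs_nonneg _).trans (hgb 0)
  have hm : Measurable (fun p : ℝ × ℝ => g p.1 * (same k p.1 p.2 * f p.2)) :=
    (hg.comp measurable_fst).mul (same_f_meas hf.meas)
  have hi : Integrable (fun p : ℝ × ℝ => g p.1 * (same k p.1 p.2 * f p.2)) (volume.prod volume) := by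
    refine bdd_integrable (B := Ico (0:ℝ) 1 ×ˢ Ico (0:ℝ) 1) (C := C * (1 * 1)) (by
      rw [Measure.prod_prod]; simp) hm ?_ ?_
    · intro p
      rw [abs_mul, abs_mul]
      exact mul_le_mul (hgb _) (mul_le_mul (same_abs _ _ _) (hf.abs_le _) (abs_nonneg _) zero_le_one)
        (by positivity) hC
    · intro p hp
      by_cases h1 : p.2 ∈ Ico (0:ℝ) 1
      · unfold same
        split_ifs with h
        · exact absurd ⟨cell_eq_mem h.symm h1, h1⟩ hp
        · simp
      · simp [hf.zero _ h1]
  have e1 : ∫ x, g x * E k f x = 2 ^ k * ∫ x, ∫ y, g x * (same k x y * f y) := by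
    rw [← integral_const_mul]
    congr 1
    funext x
    rw [integral_const_mul]
    unfold E
    ring
  rw [e1, integral_integral_swap hi, ← integral_const_mul]
  congr 1
  funext y
  have e2 : ∀ x, g x * (same k x y * f y) = g y * f y * same k y x := by
    intro x
    rw [same_symm k y x]
    unfold same
    split_ifs with h
    · rw [hcc x y h]; ring
    · simp
  simp only [e2]
  rw [integral_const_mul, same_int]
  field_simp

theorem cell_nest {k k' : ℕ} (h : k ≤ k') {x y : ℝ} (hxy : cell k' x = cell k' y) : cell k x = cell k y := by
  obtain ⟨m, rfl⟩ := Nat.exists_eq_add_of_le h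
  have hc : ∀ z, cell k z = cell (k + m) z / ((2 ^ m : ℕ) : ℤ) := by
    intro z
    unfold cell
    rw [← Int.floor_div_natCast]
    congr 1
    push_cast
    rw [pow_add]
    field_simp
  rw [hc, hc, hxy]

theorem CC.mono {k k' : ℕ} (h : k ≤ k') {g : ℝ → ℝ} (hg : CC k g) : CC k' g :=
  fun x y hxy => hg x y (cell_nest h hxy)

theorem energy {f : ℝ → ℝ} (hf : Nice f) {k k' : ℕ} (h : k ≤ k') :
    ∫ x, (E k' f x - E k f x) ^ 2 = (∫ x, E k' f x ^ 2) - ∫ x, E k f x ^ 2 := by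
  have n := E_nice hf k
  have n' := E_nice hf k'
  have h1 := key hf k' n.meas n.abs_le ((E_CC k f).mono h)
  have h2 := key hf k n.meas n.abs_le (E_CC k f)
  have i1 : Integrable (fun x => E k' f x ^ 2) := by simpa only [sq] using (n'.mul n').intble
  have i2 : Integrable (fun x => E k f x * E k' f x) := (n.mul n').intble
  have i3 : Integrable (fun x => E k f x ^ 2) := by simpa only [sq] using (n.mul n).intble
  have e : (fun x => (E k' f x - E k f x) ^ 2) =
      fun x => E k' f x ^ 2 - 2 * (E k f x * E k' f x) + E k f x ^ 2 := by funext x; ring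
  have i4 : Integrable (fun x => E k' f x ^ 2 - 2 * (E k f x * E k' f x)) := i1.sub (i2.const_mul 2)
  rw [e, integral_add i4 i3, integral_sub i1 (i2.const_mul 2), integral_const_mul, h1, ← h2]
  simp only [sq]
  ring

theorem prim_bd {f : ℝ → ℝ} (hf : Nice f) (k : ℕ) (y : ℝ) :
    |∫ t in (0:ℝ)..y, (f t - E k f t)| ≤ 2 * (1 / 2 ^ k) := by
  have h2 : (0:ℝ) < 2 ^ k := by positivity
  have n := E_nice hf k
  have hi : Integrable (fun t => f t - E k f t) := hf.intble.sub n.intble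
  have hb : ∀ t, |f t - E k f t| ≤ 1 := fun t => by
    rw [abs_le]; constructor <;> linarith [hf.nonneg t, hf.le_one t, n.nonneg t, n.le_one t]
  have hP : ∀ y : ℝ, |∫ t in Iic y, (f t - E k f t)| ≤ 1 / 2 ^ k := by
    intro y
    set a : ℝ := (cell k y : ℝ) / 2 ^ k with ha
    have hay : a ≤ y := by
      rw [ha, div_le_iff₀ h2, mul_comm]; exact Int.floor_le _
    have hya : y - a ≤ 1 / 2 ^ k := by
      have : 2 ^ k * y < cell k y + 1 := Int.lt_floor_add_one _
      rw [ha, sub_le_iff_le_add, ← add_div, le_div_iff₀ h2]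
      linarith
    set g : ℝ → ℝ := (Iio a).indicator fun _ => 1 with hg
    have hgm : Measurable g := measurable_const.indicator measurableSet_Iio
    have hgb : ∀ x, |g x| ≤ 1 := fun x => by
      simp only [hg, indicator]; split_ifs <;> simp
    have hgc : CC k g := by
      intro u v huv
      have : ∀ u, u ∈ Iio a ↔ cell k u < cell k y := by
        intro u
        rw [mem_Iio, ha, lt_div_iff₀ h2, mul_comm]
        unfold cell
        rw [Int.floor_lt]
      simp only [hg, indicator, this, huv]
    have h0 := key hf k hgm hgb hgc
    have h0' : ∫ t in Iio a, (f t - E k f t) = 0 := by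
      rw [← integral_indicator measurableSet_Iio]
      have : (Iio a).indicator (fun t => f t - E k f t) = fun t => g t * f t - g t * E k f t := by
        funext t; simp only [hg, indicator]; split_ifs <;> simp
      rw [this, integral_sub (hf.mul_intble hgm hgb) (n.mul_intble hgm hgb), h0, sub_self]
    have hu : Iic y = Iio a ∪ Icc a y := by
      ext t
      simp only [mem_Iic, mem_union, mem_Iio, mem_Icc]
      constructor
      · intro h; by_cases h' : t < a
        · exact Or.inl h'
        · exact Or.inr ⟨not_lt.1 h', h⟩
      · rintro (h | h)
        · linarith
        · exact h.2
    rw [hu, setIntegral_union (by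
      rw [disjoint_left]; intro t h1 h2; exact absurd h1 (not_lt.2 h2.1)) measurableSet_Icc
      hi.integrableOn hi.integrableOn, h0', zero_add]
    have := norm_setIntegral_le_of_norm_le_const (μ := volume) (s := Icc a y) (C := 1)
      (f := fun t => f t - E k f t) (by simp) (fun t _ => hb t)
    rw [Real.norm_eq_abs, Measure.real, Real.volume_Icc, ENNReal.toReal_ofReal (by linarith)] at this
    linarith
  have := intervalIntegral.integral_Iic_sub_Iic (hi.integrableOn (s := Iic 0)) (hi.integrableOn (s := Iic y))
  rw [← this]
  exact (abs_sub _ _).trans (by linarith [hP 0, hP y])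

theorem shift_pt {f : ℝ → ℝ} (hf : Nice f) (k : ℕ) (x y : ℝ) :
    |E k f (x + y) - E k f x| ≤ ∑ n ∈ Finset.range (2 ^ k + 1),
      (Icc ((n:ℝ) / 2 ^ k - |y|) ((n:ℝ) / 2 ^ k + |y|)).indicator (fun _ => (1:ℝ)) x := by
  have h2 : (0:ℝ) < 2 ^ k := by positivity
  have n := E_nice hf k
  have hnn : ∀ m ∈ Finset.range (2 ^ k + 1),
      0 ≤ (Icc ((m:ℝ) / 2 ^ k - |y|) ((m:ℝ) / 2 ^ k + |y|)).indicator (fun _ => (1:ℝ)) x :=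
    fun m _ => indicator_nonneg (fun _ _ => zero_le_one) _
  by_cases heq : E k f (x + y) = E k f x
  · rw [heq, sub_self, abs_zero]; exact Finset.sum_nonneg hnn
  have hle : |E k f (x + y) - E k f x| ≤ 1 := by
    rw [abs_le]; constructor <;> linarith [n.nonneg x, n.le_one x, n.nonneg (x + y), n.le_one (x + y)]
  refine hle.trans ?_
  -- find the integer
  have hfind : ∀ u v : ℝ, cell k u < cell k v → (u ∈ Ico (0:ℝ) 1 ∨ v ∈ Ico (0:ℝ) 1) →
      ∃ m : ℕ, m ∈ Finset.range (2 ^ k + 1) ∧ u ≤ m / 2 ^ k ∧ m / 2 ^ k ≤ v := by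
    intro u v huv h
    rcases h with h | h
    · rw [cell_mem k] at h
      obtain ⟨m, hm⟩ := Int.eq_ofNat_of_zero_le (show 0 ≤ cell k u + 1 by linarith [h.1])
      have hm' : (cell k u : ℝ) + 1 = m := by exact_mod_cast hm
      refine ⟨m, ?_, ?_, ?_⟩
      · rw [Finset.mem_range]
        have : (m:ℤ) ≤ 2 ^ k := by rw [← hm]; have := h.2; omega
        have : m ≤ 2 ^ k := by exact_mod_cast this
        omega
      · rw [le_div_iff₀ h2, ← hm', mul_comm]; exact (Int.lt_floor_add_one _).le
      · rw [div_le_iff₀ h2, ← hm', mul_comm]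
        have h3 : (cell k v : ℝ) ≤ 2 ^ k * v := Int.floor_le _
        have h4 : (cell k u : ℝ) + 1 ≤ cell k v := by exact_mod_cast huv
        linarith
    · rw [cell_mem k] at h
      obtain ⟨m, hm⟩ := Int.eq_ofNat_of_zero_le h.1
      have hm' : (cell k v : ℝ) = m := by exact_mod_cast hm
      refine ⟨m, ?_, ?_, ?_⟩
      · rw [Finset.mem_range]
        have : (m:ℤ) < 2 ^ k := by rw [← hm]; exact h.2
        have : m < 2 ^ k := by exact_mod_cast this
        omega
      · rw [le_div_iff₀ h2, ← hm', mul_comm]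
        have h3 : 2 ^ k * u < (cell k u : ℝ) + 1 := Int.lt_floor_add_one _
        have h4 : (cell k u : ℝ) + 1 ≤ cell k v := by exact_mod_cast huv
        linarith
      · rw [div_le_iff₀ h2, ← hm', mul_comm]; exact Int.floor_le _
  have hor : x + y ∈ Ico (0:ℝ) 1 ∨ x ∈ Ico (0:ℝ) 1 := by
    by_contra hno
    push Not at hno
    exact heq (by rw [n.zero _ hno.1, n.zero _ hno.2])
  have hne : cell k (x + y) ≠ cell k x := fun h => heq (E_CC k f _ _ h)
  have : ∃ m : ℕ, m ∈ Finset.range (2 ^ k + 1) ∧ x ∈ Icc ((m:ℝ) / 2 ^ k - |y|) ((m:ℝ) / 2 ^ k + |y|) := by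
    rcases lt_or_gt_of_ne hne with h | h
    · obtain ⟨m, hm, h3, h4⟩ := hfind _ _ h hor
      exact ⟨m, hm, by linarith [abs_nonneg y], by linarith [neg_abs_le y]⟩
    · obtain ⟨m, hm, h3, h4⟩ := hfind _ _ h hor.symm
      exact ⟨m, hm, by linarith [le_abs_self y], by linarith [abs_nonneg y]⟩
  obtain ⟨m, hm, hx⟩ := this
  calc (1:ℝ) = (Icc ((m:ℝ) / 2 ^ k - |y|) ((m:ℝ) / 2 ^ k + |y|)).indicator (fun _ => (1:ℝ)) x := by
        simp only [hx, indicator_of_mem]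
    _ ≤ _ := Finset.single_le_sum hnn hm

theorem shift_int {f : ℝ → ℝ} (hf : Nice f) (k : ℕ) (y : ℝ) :
    ∫ x, |E k f (x + y) - E k f x| ≤ 4 * 2 ^ k * |y| := by
  have n := E_nice hf k
  have hi : ∀ m ∈ Finset.range (2 ^ k + 1), Integrable (fun x =>
      (Icc ((m:ℝ) / 2 ^ k - |y|) ((m:ℝ) / 2 ^ k + |y|)).indicator (fun _ => (1:ℝ)) x) := fun m _ =>
    (integrable_indicator_iff measurableSet_Icc).2 (integrableOn_const (by simp))
  have h1 : ∫ x, |E k f (x + y) - E k f x| ≤ ∫ x, ∑ m ∈ Finset.range (2 ^ k + 1),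
      (Icc ((m:ℝ) / 2 ^ k - |y|) ((m:ℝ) / 2 ^ k + |y|)).indicator (fun _ => (1:ℝ)) x := by
    refine integral_mono ((n.intble.comp_add_right y).sub n.intble).abs (integrable_finsetSum _ hi)
      fun x => shift_pt hf k x y
  refine h1.trans ?_
  rw [integral_finsetSum _ hi]
  have : ∀ m ∈ Finset.range (2 ^ k + 1), ∫ x, (Icc ((m:ℝ) / 2 ^ k - |y|)
      ((m:ℝ) / 2 ^ k + |y|)).indicator (fun _ => (1:ℝ)) x = 2 * |y| := by
    intro m _
    rw [integral_indicator_const _ measurableSet_Icc, Measure.real, Real.volume_Icc, ENNReal.toReal_ofReal]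
    · simp; ring
    · linarith [abs_nonneg y]
  rw [Finset.sum_congr rfl this, Finset.sum_const, Finset.card_range, nsmul_eq_mul]
  push_cast
  have h3 : (1:ℝ) ≤ 2 ^ k := one_le_pow₀ (by norm_num)
  nlinarith [mul_le_mul_of_nonneg_right h3 (abs_nonneg y)]

theorem cube_bd {f : ℝ → ℝ} (hf : Nice f) {k k' : ℕ} (h : k ≤ k') :
    (∫ x, f x) ^ 3 ≤ ∫ x, E k f x * f x * E k' f x := by
  have n := E_nice hf k
  have n' := E_nice hf k'
  have nn := n.mul n
  set m := ∫ x, f x with hm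
  have hm0 : 0 ≤ m := integral_nonneg hf.nonneg
  -- E k f * E k' f is CC k'
  have c1 : CC k' (fun x => E k f x * E k' f x) := fun x y hxy => by
    simp only [(E_CC k f).mono h x y hxy, E_CC k' f x y hxy]
  have h1 := key hf k' (n.mul n').meas (n.mul n').abs_le c1
  have c2 : CC k' (fun x => E k f x * E k f x) := fun x y hxy => by
    simp only [(E_CC k f).mono h x y hxy]
  have h2 := key hf k' nn.meas nn.abs_le c2
  have c3 : CC k (fun x => E k f x * E k f x) := fun x y hxy => by
    simp only [E_CC k f x y hxy]
  have h3 := key hf k nn.meas nn.abs_le c3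
  have h4 := key hf k (g := fun _ => 1) (C := 1) measurable_const (by simp) (fun _ _ _ => rfl)
  simp only [one_mul] at h4
  have i1 : Integrable (fun x => E k f x * E k' f x * E k' f x) := ((n.mul n').mul n').intble
  have i2 : Integrable (fun x => E k f x * E k f x * E k' f x) := (nn.mul n').intble
  have i3 : Integrable (fun x => E k f x * E k f x * E k f x) := (nn.mul n).intble
  -- step 1
  have s1 : 0 ≤ ∫ x, (E k f x * E k' f x * E k' f x - 2 * (E k f x * E k f x * E k' f x)
      + E k f x * E k f x * E k f x) := by
    refine integral_nonneg fun x => ?_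
    have := mul_nonneg (n.nonneg x) (sq_nonneg (E k' f x - E k f x))
    show (0:ℝ) ≤ _
    linarith
  have i4 : Integrable (fun x => E k f x * E k' f x * E k' f x - 2 * (E k f x * E k f x * E k' f x)) :=
    i1.sub (i2.const_mul 2)
  rw [integral_add i4 i3, integral_sub i1 (i2.const_mul 2), integral_const_mul, h1, h2, ← h3] at s1
  -- step 2
  have s2 : ∫ x, (3 * m ^ 2 * E k f x - (Ico (0:ℝ) 1).indicator (fun _ => 2 * m ^ 3) x) ≤
      ∫ x, E k f x * E k f x * E k f x := by
    refine integral_mono ((n.intble.const_mul _).sub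
      ((integrable_indicator_iff measurableSet_Ico).2 (integrableOn_const (by simp)))) i3 fun x => ?_
    by_cases hx : x ∈ Ico (0:ℝ) 1
    · simp only [hx, indicator_of_mem]
      have := mul_nonneg (by linarith [n.nonneg x] : 0 ≤ E k f x + 2 * m) (sq_nonneg (E k f x - m))
      nlinarith
    · simp [hx, n.zero x hx]
  rw [integral_sub (n.intble.const_mul _)
      ((integrable_indicator_iff measurableSet_Ico).2 (integrableOn_const (by simp))),
    integral_const_mul, integral_indicator_const _ measurableSet_Ico, h4, ← hm] at s2
  simp at s2
  have s3 : ∫ x, E k f x * f x * E k' f x = ∫ x, E k f x * E k' f x * f x := by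
    congr 1; funext x; ring
  rw [s3]
  nlinarith

end PR

namespace PR

theorem same_close {k : ℕ} {x y : ℝ} (h : cell k x = cell k y) : y ≤ x + 1 / 2 ^ k := by
  have h2 : (0:ℝ) < 2 ^ k := by positivity
  have h3 : (cell k x : ℝ) ≤ 2 ^ k * x := Int.floor_le _
  have h4 : 2 ^ k * y < (cell k y : ℝ) + 1 := Int.lt_floor_add_one _
  rw [← h] at h4
  rw [← sub_le_iff_le_add', le_div_iff₀ h2]
  linarith

/-- lower bound for the ordered correlation within cells -/
theorem ord_bd {f : ℝ → ℝ} (hf : Nice f) {k k' : ℕ} (h : k ≤ k') :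
    (∫ x, f x) ^ 3 / 2 ^ k' / 2 ≤
      ∫ x, ∫ y, (f x * E k f x) * (f y * same k' x y * (if x ≤ y then 1 else 0)) := by
  have h2 : (0:ℝ) < 2 ^ k' := by positivity
  have n := E_nice hf k
  set G : ℝ × ℝ → ℝ := fun p => (f p.1 * E k f p.1) * (f p.2 * same k' p.1 p.2) with hG
  set A : ℝ × ℝ → ℝ := fun p => (f p.1 * E k f p.1) * (f p.2 * same k' p.1 p.2 *
    (if p.1 ≤ p.2 then 1 else 0)) with hA
  set A' : ℝ × ℝ → ℝ := fun p => (f p.1 * E k f p.1) * (f p.2 * same k' p.1 p.2 *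
    (if p.2 ≤ p.1 then 1 else 0)) with hA'
  have hsm := same_meas k'
  have hfm := hf.meas
  have hnm := n.meas
  have hGm : Measurable G := by
    simp only [hG]; exact ((hfm.comp measurable_fst).mul (hnm.comp measurable_fst)).mul
      ((hfm.comp measurable_snd).mul hsm)
  have hle : ∀ p : ℝ × ℝ, 0 ≤ G p ∧ G p ≤ 1 := by
    intro p
    refine ⟨mul_nonneg ((hf.mul n).nonneg _) (mul_nonneg (hf.nonneg _) (same_nonneg _ _ _)), ?_⟩
    exact mul_le_one₀ ((hf.mul n).le_one _) (mul_nonneg (hf.nonneg _) (same_nonneg _ _ _))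
      (mul_le_one₀ (hf.le_one _) (same_nonneg _ _ _) (same_le_one _ _ _))
  have hG0 : ∀ p, p ∉ Ico (0:ℝ) 1 ×ˢ Ico (0:ℝ) 1 → G p = 0 := by
    intro p hp
    by_cases h1 : p.1 ∈ Ico (0:ℝ) 1
    · by_cases h3 : p.2 ∈ Ico (0:ℝ) 1
      · exact absurd ⟨h1, h3⟩ hp
      · simp [hG, hf.zero _ h3]
    · simp [hG, hf.zero _ h1]
  have hAG : ∀ p, A p = G p * (if p.1 ≤ p.2 then 1 else 0) := fun p => by simp only [hA, hG]; ring
  have hAG' : ∀ p, A' p = G p * (if p.2 ≤ p.1 then 1 else 0) := fun p => by simp only [hA', hG]; ring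
  have hvol : (volume.prod volume) (Ico (0:ℝ) 1 ×ˢ Ico (0:ℝ) 1) < ⊤ := by
    rw [Measure.prod_prod]; simp
  have iG : Integrable G (volume.prod volume) := bdd_integrable (C := 1) hvol hGm
    (fun p => by rw [abs_of_nonneg (hle p).1]; exact (hle p).2) hG0
  have hite : ∀ (s : Prop) [Decidable s], 0 ≤ (if s then (1:ℝ) else 0) ∧ (if s then (1:ℝ) else 0) ≤ 1 := by
    intro s _; split_ifs <;> norm_num
  have hAm : Measurable A := by
    rw [show A = _ from funext hAG]
    exact hGm.mul (Measurable.ite (measurableSet_le measurable_fst measurable_snd) measurable_const measurable_const)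
  have hAm' : Measurable A' := by
    rw [show A' = _ from funext hAG']
    exact hGm.mul (Measurable.ite (measurableSet_le measurable_snd measurable_fst) measurable_const measurable_const)
  have iA : Integrable A (volume.prod volume) := iG.mono' hAm.aestronglyMeasurable
    (Filter.Eventually.of_forall fun p => by
      rw [hAG, Real.norm_eq_abs, abs_of_nonneg (mul_nonneg (hle p).1 (hite _).1)]
      exact mul_le_of_le_one_right (hle p).1 (hite _).2)
  have iA' : Integrable A' (volume.prod volume) := iG.mono' hAm'.aestronglyMeasurable
    (Filter.Eventually.of_forall fun p => by
      rw [hAG', Real.norm_eq_abs, abs_of_nonneg (mul_nonneg (hle p).1 (hite _).1)]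
      exact mul_le_of_le_one_right (hle p).1 (hite _).2)
  have hswap : ∫ p, A' p ∂(volume.prod volume) = ∫ p, A p ∂(volume.prod volume) := by
    rw [← mp_integral (Measure.measurePreserving_swap (μ := (volume : Measure ℝ)) (ν := (volume : Measure ℝ))) hAm']
    congr 1
    funext p
    simp only [hA, hA', Prod.fst_swap, Prod.snd_swap]
    unfold same
    by_cases hc : cell k' p.2 = cell k' p.1
    · rw [if_pos hc, if_pos hc.symm, (E_CC k f).mono h _ _ hc]
      ring
    · have hc' : ¬ cell k' p.1 = cell k' p.2 := fun h' => hc h'.symm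
      simp only [hc, hc', if_false, mul_zero, zero_mul]
  have hsum : ∫ p, G p ∂(volume.prod volume) ≤ (∫ p, A p ∂(volume.prod volume)) + ∫ p, A' p ∂(volume.prod volume) := by
    rw [← integral_add iA iA']
    refine integral_mono iG (iA.add iA') fun p => ?_
    simp only [hAG, hAG', ← mul_add]
    refine le_mul_of_one_le_right (hle p).1 ?_
    rcases le_total p.1 p.2 with h | h <;> simp only [h, if_true] <;> linarith [(hite (p.1 ≤ p.2)).1, (hite (p.2 ≤ p.1)).1]
  have hGint : ∫ p, G p ∂(volume.prod volume) = (1 / 2 ^ k') * ∫ x, E k f x * f x * E k' f x := by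
    rw [integral_prod _ iG, ← integral_const_mul]
    congr 1
    funext x
    simp only [hG]
    rw [integral_const_mul]
    have : ∫ y, f y * same k' x y = (1 / 2 ^ k') * E k' f x := by
      unfold E
      rw [← mul_assoc, one_div, inv_mul_cancel₀ h2.ne', one_mul]
      congr 1; funext y; ring
    rw [this]; ring
  have hc := cube_bd hf h
  have e : ∫ x, ∫ y, (f x * E k f x) * (f y * same k' x y * (if x ≤ y then 1 else 0)) =
      ∫ p, A p ∂(volume.prod volume) := (integral_prod _ iA).symm
  rw [e]
  rw [hswap, hGint] at hsum
  have : (∫ x, f x) ^ 3 / 2 ^ k' ≤ (1 / 2 ^ k') * ∫ x, E k f x * f x * E k' f x := by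
    rw [div_eq_inv_mul, one_div]
    exact mul_le_mul_of_nonneg_left hc (by positivity)
  linarith

theorem main_lb {f : ℝ → ℝ} (hf : Nice f) {k : ℕ} {lam r : ℝ} (hl : 0 < lam) (hr : 0 < r)
    (hk : lam * r ≤ (1 / 2) ^ k) :
    r / 4 * (∫ x, f x) ^ 3 ≤ Lam lam (fun _ => 0) ((Icc 0 r).indicator fun _ => 1) f f (E k f) := by
  have n := E_nice hf k
  have hlr : 0 < lam * r := by positivity
  obtain ⟨m, hm1, hm2⟩ := exists_nat_pow_near_of_lt_one hlr
    (hk.trans (pow_le_one₀ (by norm_num) (by norm_num))) (by norm_num : (0:ℝ) < 1 / 2) (by norm_num)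
  set k' := m + 1 with hk'
  have hkk : k ≤ k' := by
    by_contra hc
    push Not at hc
    have : ((1:ℝ) / 2) ^ k ≤ (1 / 2) ^ k' := pow_le_pow_of_le_one (by norm_num) (by norm_num) hc.le
    linarith
  have hA := ord_bd hf hkk
  have h2 : (0:ℝ) < 2 ^ k' := by positivity
  have hp1 : 1 / 2 ^ k' ≤ lam * r := by rw [← one_div_pow]; exact hm1.le
  have hp2 : lam * r / 2 ≤ 1 / 2 ^ k' := by
    rw [← one_div_pow, hk', pow_succ]; linarith
  have hχm : Measurable ((Icc 0 r).indicator fun _ : ℝ => (1:ℝ)) := measurable_const.indicator measurableSet_Icc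
  have hχi : Integrable ((Icc 0 r).indicator fun _ : ℝ => (1:ℝ)) :=
    (integrable_indicator_iff measurableSet_Icc).2 (integrableOn_const (by simp))
  have hi := (Lam_intble (lam := lam) (q := fun _ => 0) measurable_const hχm hf.meas hf.meas n.meas hf.abs_le hf.abs_le
    hχi n.intble).1
  have e1 : Lam lam (fun _ => 0) ((Icc 0 r).indicator fun _ => 1) f f (E k f) =
      ∫ x, ∫ t, f x * f (x + lam * t) * E k f (x + 0) * (Icc 0 r).indicator (fun _ => (1:ℝ)) t := integral_prod _ hi
  have hi' : Integrable (fun x => ∫ t, f x * f (x + lam * t) * E k f (x + 0) * (Icc 0 r).indicator (fun _ => (1:ℝ)) t) :=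
    Integrable.integral_prod_left hi
  have e2 : ∀ x, ∫ t, f x * f (x + lam * t) * E k f (x + 0) * (Icc 0 r).indicator (fun _ => (1:ℝ)) t =
      lam⁻¹ * ((f x * E k f x) * ∫ y, f y * (Icc x (x + lam * r)).indicator (fun _ => (1:ℝ)) y) := by
    intro x
    have s1 : ∀ t, f x * f (x + lam * t) * E k f (x + 0) * (Icc 0 r).indicator (fun _ => (1:ℝ)) t =
        (f x * E k f x) * (f (x + lam * t) * (Icc x (x + lam * r)).indicator (fun _ => (1:ℝ)) (x + lam * t)) := by
      intro t
      have : x + lam * t ∈ Icc x (x + lam * r) ↔ t ∈ Icc 0 r := by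
        simp only [mem_Icc, le_add_iff_nonneg_right, add_le_add_iff_left]
        rw [mul_nonneg_iff_of_pos_left hl, mul_le_mul_iff_right₀ hl]
      simp only [indicator, this, add_zero]
      ring
    simp only [s1]
    rw [integral_const_mul]
    have s2 := Measure.integral_comp_mul_left
      (fun u => f (x + u) * (Icc x (x + lam * r)).indicator (fun _ => (1:ℝ)) (x + u)) lam
    rw [s2, integral_add_left_eq_self (fun u => f u * (Icc x (x + lam * r)).indicator (fun _ => (1:ℝ)) u) x,
      smul_eq_mul, abs_of_pos (by positivity)]
    ring
  rw [e1]
  simp only [e2] at hi' ⊢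
  rw [integral_const_mul]
  have hBint : Integrable (fun x => (f x * E k f x) * ∫ y, f y * (Icc x (x + lam * r)).indicator (fun _ => (1:ℝ)) y) := by
    have := hi'.const_mul lam
    refine this.congr (Filter.Eventually.of_forall fun x => ?_)
    show lam * (lam⁻¹ * _) = _
    rw [← mul_assoc, mul_inv_cancel₀ hl.ne', one_mul]
  have hmono : ∫ x, ∫ y, (f x * E k f x) * (f y * same k' x y * (if x ≤ y then 1 else 0)) ≤
      ∫ x, (f x * E k f x) * ∫ y, f y * (Icc x (x + lam * r)).indicator (fun _ => (1:ℝ)) y := by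
    refine integral_mono_of_nonneg (Filter.Eventually.of_forall fun x => integral_nonneg fun y => ?_) hBint
      (Filter.Eventually.of_forall fun x => ?_)
    · refine mul_nonneg ((hf.mul n).nonneg _) (mul_nonneg (mul_nonneg (hf.nonneg _) (same_nonneg _ _ _)) ?_)
      split_ifs <;> norm_num
    · show ∫ y, _ ≤ _
      rw [integral_const_mul]
      refine mul_le_mul_of_nonneg_left ?_ ((hf.mul n).nonneg _)
      refine integral_mono_of_nonneg (Filter.Eventually.of_forall fun y => ?_) ?_
        (Filter.Eventually.of_forall fun y => ?_)
      · refine mul_nonneg (mul_nonneg (hf.nonneg _) (same_nonneg _ _ _)) ?_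
        split_ifs <;> norm_num
      · have := hf.mul_intble (g := (Icc x (x + lam * r)).indicator (fun _ => (1:ℝ))) (C := 1)
          (measurable_const.indicator measurableSet_Icc) (fun y => by simp only [indicator]; split_ifs <;> simp)
        exact this.congr (Filter.Eventually.of_forall fun y => mul_comm _ _)
      · show f y * same k' x y * _ ≤ f y * _
        rw [mul_assoc]
        refine mul_le_mul_of_nonneg_left ?_ (hf.nonneg y)
        unfold same
        by_cases hc : cell k' x = cell k' y
        · by_cases hxy : x ≤ y
          · have : y ∈ Icc x (x + lam * r) := ⟨hxy, (same_close hc).trans (by linarith)⟩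
            simp [this, hc, hxy]
          · simp only [hxy, if_false, mul_zero]
            exact indicator_nonneg (fun _ _ => zero_le_one) _
        · simp only [hc, if_false, zero_mul]
          exact indicator_nonneg (fun _ _ => zero_le_one) _
  have hm3 : 0 ≤ (∫ x, f x) ^ 3 := pow_nonneg (integral_nonneg hf.nonneg) 3
  have hfin : lam * r / 2 * (∫ x, f x) ^ 3 / 2 ≤
      ∫ x, (f x * E k f x) * ∫ y, f y * (Icc x (x + lam * r)).indicator (fun _ => (1:ℝ)) y := by
    refine le_trans ?_ (hA.trans hmono)
    have := mul_le_mul_of_nonneg_right hp2 hm3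
    have e5 : (∫ x, f x) ^ 3 / 2 ^ k' = 1 / 2 ^ k' * (∫ x, f x) ^ 3 := by ring
    rw [e5]; linarith
  calc r / 4 * (∫ x, f x) ^ 3 = lam⁻¹ * (lam * r / 2 * (∫ x, f x) ^ 3 / 2) := by field_simp; norm_num; ring
    _ ≤ _ := mul_le_mul_of_nonneg_left hfin (by positivity)

theorem main_term {f χ q : ℝ → ℝ} (hf : Nice f) {k : ℕ} {lam r M β : ℝ} (hl : 0 < lam) (hr : 0 < r)
    (hk : lam * r ≤ (1 / 2) ^ k) (hq : Measurable q) (hM : 0 ≤ M) (hqb : ∀ t ∈ Icc 0 r, |q t| ≤ M * t)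
    (hχ : Measurable χ) (hχ0 : ∀ t, 0 ≤ χ t) (hχ1 : ∀ t, χ t ≤ 1) (hχs : ∀ t, t ∉ Icc 0 r → χ t = 0)
    (hβ : ∫ t, |(Icc 0 r).indicator (fun _ => (1:ℝ)) t - χ t| ≤ β) :
    r / 4 * (∫ x, f x) ^ 3 - 4 * 2 ^ k * M * r ^ 2 - β ≤ Lam lam q χ f f (E k f) := by
  have n := E_nice hf k
  have h1 := main_lb hf hl hr hk
  have hum : Measurable ((Icc 0 r).indicator fun _ : ℝ => (1:ℝ)) := measurable_const.indicator measurableSet_Icc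
  have hui : Integrable ((Icc 0 r).indicator fun _ : ℝ => (1:ℝ)) :=
    (integrable_indicator_iff measurableSet_Icc).2 (integrableOn_const (by simp))
  have hχi : Integrable χ := bdd_integrable (B := Icc 0 r) (C := 1) (by simp) hχ
    (fun t => by rw [abs_of_nonneg (hχ0 t)]; exact hχ1 t) hχs
  have hEint : ∫ t, |E k f t| ≤ 1 := by
    have : ∫ t, |E k f t| ≤ ∫ t, (Ico (0:ℝ) 1).indicator (fun _ => (1:ℝ)) t := by
      refine integral_mono n.intble.abs ((integrable_indicator_iff measurableSet_Ico).2
        (integrableOn_const (by simp))) fun t => ?_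
      by_cases ht : t ∈ Ico (0:ℝ) 1
      · simp only [ht, indicator_of_mem]; exact n.abs_le t
      · simp [ht, n.zero t ht]
    rw [integral_indicator_const _ measurableSet_Ico] at this
    simpa using this
  -- replace the cutoff
  have d2 : |Lam lam (fun _ => 0) ((Icc 0 r).indicator fun _ => 1) f f (E k f) -
      Lam lam (fun _ => 0) χ f f (E k f)| ≤ β := by
    have h3 := (Lam_intble (lam := lam) (q := fun _ => 0) measurable_const (hum.sub hχ) hf.meas hf.meas n.meas
      hf.abs_le hf.abs_le (hui.sub hχi) n.intble).2
    have e : Lam lam (fun _ => 0) ((Icc 0 r).indicator fun _ => 1) f f (E k f) -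
      Lam lam (fun _ => 0) χ f f (E k f) =
      Lam lam (fun _ => 0) (((Icc 0 r).indicator fun _ => 1) - χ) f f (E k f) := by
      unfold Lam
      rw [← integral_sub (Lam_intble (q := fun _ => 0) measurable_const hum hf.meas hf.meas n.meas hf.abs_le hf.abs_le hui n.intble).1
        (Lam_intble (q := fun _ => 0) measurable_const hχ hf.meas hf.meas n.meas hf.abs_le hf.abs_le hχi n.intble).1]
      congr 1
      funext p
      simp only [Pi.sub_apply]
      ring
    rw [e]
    refine h3.trans ?_
    calc _ ≤ 1 * β := mul_le_mul hEint hβ (integral_nonneg fun _ => abs_nonneg _) zero_le_one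
      _ = β := one_mul β
  -- remove the shift
  have d1 : |Lam lam q χ f f (E k f) - Lam lam (fun _ => 0) χ f f (E k f)| ≤ 4 * 2 ^ k * M * r ^ 2 := by
    unfold Lam
    rw [← integral_sub (Lam_intble hq hχ hf.meas hf.meas n.meas hf.abs_le hf.abs_le hχi n.intble).1
        (Lam_intble (q := fun _ => 0) measurable_const hχ hf.meas hf.meas n.meas hf.abs_le hf.abs_le hχi n.intble).1]
    have i0 : Integrable (fun p : ℝ × ℝ => E k f p.1 * χ p.2) := n.intble.mul_prod hχi
    have i1 : Integrable (fun p : ℝ × ℝ => E k f (p.1 + q p.2) * χ p.2) :=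
      (mp_shearq hq).integrable_comp_of_integrable i0
    have i2 : Integrable (fun p : ℝ × ℝ => |E k f (p.1 + q p.2) - E k f p.1| * χ p.2) := by
      refine (i1.sub i0).abs.congr (Filter.Eventually.of_forall fun p => ?_)
      show |E k f (p.1 + q p.2) * χ p.2 - E k f p.1 * χ p.2| = _
      rw [← sub_mul, abs_mul, abs_of_nonneg (hχ0 _)]
    have hb : ∀ p : ℝ × ℝ, ‖f p.1 * f (p.1 + lam * p.2) * E k f (p.1 + q p.2) * χ p.2 -
          f p.1 * f (p.1 + lam * p.2) * E k f (p.1 + 0) * χ p.2‖ ≤ |E k f (p.1 + q p.2) - E k f p.1| * χ p.2 := by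
      intro p
      have : f p.1 * f (p.1 + lam * p.2) * E k f (p.1 + q p.2) * χ p.2 -
          f p.1 * f (p.1 + lam * p.2) * E k f (p.1 + 0) * χ p.2 =
          f p.1 * f (p.1 + lam * p.2) * ((E k f (p.1 + q p.2) - E k f p.1) * χ p.2) := by
        rw [add_zero]; ring
      rw [this, norm_mul, norm_mul, norm_mul, Real.norm_eq_abs, Real.norm_eq_abs, Real.norm_eq_abs,
        Real.norm_eq_abs, abs_of_nonneg (hχ0 _)]
      refine mul_le_of_le_one_left (mul_nonneg (abs_nonneg _) (hχ0 _)) ?_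
      exact mul_le_one₀ (hf.abs_le _) (abs_nonneg _) (hf.abs_le _)
    have hn := norm_integral_le_of_norm_le i2 (Filter.Eventually.of_forall hb)
    rw [Real.norm_eq_abs] at hn
    refine hn.trans ?_
    · rw [Measure.volume_eq_prod, integral_prod_symm _ i2]
      simp only [integral_mul_const]
      have hle : ∀ t, (∫ x, |E k f (x + q t) - E k f x|) * χ t ≤ (Icc 0 r).indicator (fun _ => 4 * 2 ^ k * (M * r)) t := by
        intro t
        by_cases ht : t ∈ Icc 0 r
        · simp only [ht, indicator_of_mem]
          have a1 := shift_int hf k (q t)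
          have a2 := hqb t ht
          have a3 : M * t ≤ M * r := mul_le_mul_of_nonneg_left ht.2 hM
          calc _ ≤ (∫ x, |E k f (x + q t) - E k f x|) * 1 :=
                mul_le_mul_of_nonneg_left (hχ1 t) (integral_nonneg fun _ => abs_nonneg _)
            _ ≤ 4 * 2 ^ k * |q t| := by rw [mul_one]; exact a1
            _ ≤ 4 * 2 ^ k * (M * r) := by gcongr; linarith
        · simp [ht, hχs t ht]
      refine (integral_mono_of_nonneg (Filter.Eventually.of_forall fun t =>
        mul_nonneg (integral_nonneg fun _ => abs_nonneg _) (hχ0 t)) ((integrable_indicator_iff measurableSet_Icc).2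
          (integrableOn_const (by simp))) (Filter.Eventually.of_forall hle)).trans ?_
      rw [integral_indicator_const _ measurableSet_Icc, Measure.real, Real.volume_Icc,
        ENNReal.toReal_ofReal (by linarith), smul_eq_mul]
      apply le_of_eq; ring
  have b1 := (abs_le.1 d1).1
  have b2 := (abs_le.1 d2).2
  linarith

theorem st_deriv : ∃ B : ℝ, 1 ≤ B ∧ ∀ x, |deriv Real.smoothTransition x| ≤ B := by
  have hc : Continuous (deriv Real.smoothTransition) :=
    (Real.smoothTransition.contDiff (n := 1)).continuous_deriv (by norm_num)
  obtain ⟨B, hB⟩ := isCompact_Icc.exists_bound_of_continuousOn (s := Icc (0:ℝ) 1) hc.continuousOn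
  refine ⟨max B 1, le_max_right _ _, fun x => ?_⟩
  by_cases hx : x ∈ Icc (0:ℝ) 1
  · exact (hB x hx).trans (le_max_left _ _)
  · have h0 : deriv Real.smoothTransition x = 0 := by
      rw [mem_Icc, not_and_or, not_le, not_le] at hx
      rcases hx with hx | hx
      · have : Real.smoothTransition =ᶠ[nhds x] fun _ => 0 := by
          filter_upwards [Iio_mem_nhds hx] with y hy using Real.smoothTransition.zero_of_nonpos (le_of_lt hy)
        rw [this.deriv_eq]; simp
      · have : Real.smoothTransition =ᶠ[nhds x] fun _ => 1 := by
          filter_upwards [Ioi_mem_nhds hx] with y hy using Real.smoothTransition.one_of_one_le (le_of_lt hy)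
        rw [this.deriv_eq]; simp
    rw [h0, abs_zero]; positivity

theorem weight : ∃ C : ℝ, 1 ≤ C ∧ ∀ r κ : ℝ, 0 < r → r ≤ 1 → 0 < κ → κ ≤ 1 →
    ∃ χ : ℝ → ℝ, ContDiff ℝ 1 χ ∧ (∀ t, 0 ≤ χ t) ∧ (∀ t, χ t ≤ 1) ∧ (∀ t, |deriv χ t| ≤ C / (κ * r)) ∧
      (∀ t, t ∉ Icc (κ * r) r → χ t = 0) ∧
      ∫ t, |(Icc 0 r).indicator (fun _ => (1:ℝ)) t - χ t| ≤ 4 * κ * r := by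
  obtain ⟨B, hB1, hB⟩ := st_deriv
  refine ⟨2 * B, by linarith, fun r κ hr hr1 hκ hκ1 => ?_⟩
  have ha : 0 < κ * r := by positivity
  set a := κ * r with ha'
  set s := Real.smoothTransition with hs
  have hsd : ∀ x, HasDerivAt s (deriv s x) x := fun x =>
    ((Real.smoothTransition.contDiff (n := 1)).differentiable (by norm_num) x).hasDerivAt
  have hsc : ContDiff ℝ 1 s := Real.smoothTransition.contDiff
  have s0 := Real.smoothTransition.nonneg
  have s1 := Real.smoothTransition.le_one
  set χ : ℝ → ℝ := fun t => s ((t - a) / a) * s ((r - t) / a) with hχ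
  have hχc : ContDiff ℝ 1 χ := (hsc.comp (by fun_prop)).mul (hsc.comp (by fun_prop))
  have hχ0 : ∀ t, 0 ≤ χ t := fun t => mul_nonneg (s0 _) (s0 _)
  have hχ1 : ∀ t, χ t ≤ 1 := fun t => mul_le_one₀ (s1 _) (s0 _) (s1 _)
  have hχs : ∀ t, t ∉ Icc a r → χ t = 0 := by
    intro t ht
    rw [mem_Icc, not_and_or, not_le, not_le] at ht
    rcases ht with h | h
    · have : s ((t - a) / a) = 0 := Real.smoothTransition.zero_of_nonpos
        (div_nonpos_of_nonpos_of_nonneg (by linarith) ha.le)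
      simp [hχ, this]
    · have : s ((r - t) / a) = 0 := Real.smoothTransition.zero_of_nonpos
        (div_nonpos_of_nonpos_of_nonneg (by linarith) ha.le)
      simp [hχ, this]
  refine ⟨χ, hχc, hχ0, hχ1, ?_, hχs, ?_⟩
  · intro t
    have d1 : HasDerivAt (fun t => s ((t - a) / a)) (deriv s ((t - a) / a) * (1 / a)) t :=
      (hsd _).comp t (((hasDerivAt_id t).sub_const a).div_const a)
    have d2 : HasDerivAt (fun t => s ((r - t) / a)) (deriv s ((r - t) / a) * (-1 / a)) t :=
      (hsd _).comp t (((hasDerivAt_id t).const_sub r).div_const a)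
    have d3 : HasDerivAt χ _ t := d1.mul d2
    rw [d3.deriv]
    have hp : 0 ≤ 1 / a := by positivity
    have ab : ∀ x, |s x| ≤ 1 := fun x => by rw [abs_of_nonneg (s0 x)]; exact s1 x
    have k1 : |deriv s ((t - a) / a) * (1 / a) * s ((r - t) / a)| ≤ B * (1 / a) * 1 := by
      rw [abs_mul, abs_mul, abs_of_nonneg hp]
      have := hB ((t - a) / a)
      have := ab ((r - t) / a)
      gcongr
    have k2 : |s ((t - a) / a) * (deriv s ((r - t) / a) * (-1 / a))| ≤ 1 * (B * (1 / a)) := by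
      have e : |(-1:ℝ) / a| = 1 / a := by rw [neg_div, abs_neg, abs_of_nonneg hp]
      rw [abs_mul, abs_mul, e]
      have := hB ((r - t) / a)
      have := ab ((t - a) / a)
      gcongr
    refine (abs_add_le _ _).trans ((add_le_add k1 k2).trans (le_of_eq ?_))
    ring
  · have hle : ∀ t, |(Icc 0 r).indicator (fun _ => (1:ℝ)) t - χ t| ≤
        (Icc 0 (2 * a)).indicator (fun _ => (1:ℝ)) t + (Icc (r - a) r).indicator (fun _ => (1:ℝ)) t := by
      intro t
      have p1 : 0 ≤ (Icc 0 (2 * a)).indicator (fun _ => (1:ℝ)) t := indicator_nonneg (fun _ _ => zero_le_one) _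
      have p2 : 0 ≤ (Icc (r - a) r).indicator (fun _ => (1:ℝ)) t := indicator_nonneg (fun _ _ => zero_le_one) _
      by_cases ht : t ∈ Icc 0 r
      · rw [indicator_of_mem ht]
        have hb : |1 - χ t| ≤ 1 := by rw [abs_le]; constructor <;> linarith [hχ0 t, hχ1 t]
        by_cases h1 : t ∈ Icc 0 (2 * a)
        · rw [indicator_of_mem h1]; linarith
        · by_cases h2 : t ∈ Icc (r - a) r
          · rw [indicator_of_mem h2]; linarith
          · have t1 : 2 * a < t := by
              by_contra h; exact h1 ⟨ht.1, not_lt.1 h⟩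
            have t2 : t < r - a := by
              by_contra h; exact h2 ⟨not_lt.1 h, ht.2⟩
            have e1 : s ((t - a) / a) = 1 := Real.smoothTransition.one_of_one_le (by
              rw [le_div_iff₀ ha]; linarith)
            have e2 : s ((r - t) / a) = 1 := Real.smoothTransition.one_of_one_le (by
              rw [le_div_iff₀ ha]; linarith)
            have : χ t = 1 := by simp [hχ, e1, e2]
            rw [this, sub_self, abs_zero]; linarith
      · have : χ t = 0 := hχs t (fun h => ht ⟨by linarith [h.1], h.2⟩)
        rw [indicator_of_notMem ht, this, sub_zero, abs_zero]; linarith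
    have j1 : Integrable ((Icc 0 (2 * a)).indicator (fun _ => (1:ℝ))) :=
      (integrable_indicator_iff measurableSet_Icc).2
        (integrableOn_const (by rw [Real.volume_Icc]; exact ENNReal.ofReal_ne_top))
    have j2 : Integrable ((Icc (r - a) r).indicator (fun _ => (1:ℝ))) :=
      (integrable_indicator_iff measurableSet_Icc).2 (integrableOn_const (by simp))
    refine (integral_mono_of_nonneg (Filter.Eventually.of_forall fun t => abs_nonneg _) (j1.add j2)
      (Filter.Eventually.of_forall hle)).trans ?_
    show ∫ t, ((Icc 0 (2 * a)).indicator (fun _ => (1:ℝ)) t + (Icc (r - a) r).indicator (fun _ => (1:ℝ)) t) ≤ _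
    rw [integral_add j1 j2, integral_indicator_const _ measurableSet_Icc,
      integral_indicator_const _ measurableSet_Icc, Measure.real, Measure.real, Real.volume_Icc, Real.volume_Icc,
      ENNReal.toReal_ofReal (by linarith), ENNReal.toReal_ofReal (by linarith)]
    simp only [smul_eq_mul, mul_one]
    rw [mul_assoc, ← ha']
    linarith

end PR

namespace PR

/-- The sum of the absolute values of the first `d + 1` coefficients. -/
noncomputable def cs (p : Polynomial ℝ) (d : ℕ) : ℝ := ∑ i ∈ Finset.range (d + 1), |p.coeff i|

theorem eval_cs {p : Polynomial ℝ} {d : ℕ} (hp : p.natDegree ≤ d) {t : ℝ} (ht : t ∈ Icc (0:ℝ) 1) :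
    |p.eval t| ≤ cs p d := by
  rw [Polynomial.eval_eq_sum_range' (Nat.lt_succ_of_le hp)]
  refine (Finset.abs_sum_le_sum_abs _ _).trans (Finset.sum_le_sum fun i _ => ?_)
  rw [abs_mul, abs_of_nonneg (pow_nonneg ht.1 i)]
  exact mul_le_of_le_one_right (abs_nonneg _) (pow_le_one₀ ht.1 ht.2)

theorem eval_cs_lin {p : Polynomial ℝ} {d : ℕ} (hp : p.natDegree ≤ d) (h0 : p.coeff 0 = 0) {t : ℝ}
    (ht : t ∈ Icc (0:ℝ) 1) : |p.eval t| ≤ cs p d * t := by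
  rw [Polynomial.eval_eq_sum_range' (Nat.lt_succ_of_le hp), cs, Finset.sum_mul]
  refine (Finset.abs_sum_le_sum_abs _ _).trans (Finset.sum_le_sum fun i _ => ?_)
  rw [abs_mul, abs_of_nonneg (pow_nonneg ht.1 i)]
  rcases Nat.eq_zero_or_pos i with rfl | hi
  · simp [h0]
  · exact mul_le_mul_of_nonneg_left (pow_le_of_le_one ht.1 ht.2 hi.ne') (abs_nonneg _)

theorem cs_deriv {p : Polynomial ℝ} {d : ℕ} (hp : p.natDegree ≤ d) : cs p.derivative d ≤ d * cs p d := by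
  have h1 : cs p.derivative d ≤ ∑ i ∈ Finset.range (d + 1), d * |p.coeff (i + 1)| := by
    refine Finset.sum_le_sum fun i hi => ?_
    rw [Polynomial.coeff_derivative, abs_mul, mul_comm]
    by_cases h : i + 1 ≤ d
    · refine mul_le_mul_of_nonneg_right ?_ (abs_nonneg _)
      rw [abs_of_nonneg (by positivity)]
      exact_mod_cast h
    · rw [Polynomial.coeff_eq_zero_of_natDegree_lt (by omega)]; simp
  refine h1.trans ?_
  rw [← Finset.mul_sum]
  refine mul_le_mul_of_nonneg_left ?_ (Nat.cast_nonneg d)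
  have h2 : ∑ i ∈ Finset.range (d + 1 + 1), |p.coeff i| = cs p d := by
    rw [Finset.sum_range_succ, Polynomial.coeff_eq_zero_of_natDegree_lt (by omega)]; simp [cs]
  rw [← h2, Finset.sum_range_succ' _ (d + 1)]
  linarith [abs_nonneg (p.coeff 0)]

theorem step (M : ℝ) (d : ℕ) (hM : 1 ≤ M) (hd : 1 < d) : ∃ A : ℝ, 128 ≤ A ∧
    ∀ (f : ℝ → ℝ) (lam : ℝ) (Q : Polynomial ℝ) (ε : ℝ) (k : ℕ), Nice f → 0 < ε → ε ≤ 1 → ε ≤ ∫ x, f x →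
    0 < lam → lam ≤ 1 → Q.Monic → Q.natDegree = d → Q.coeff 0 = 0 → cs Q d ≤ M →
    A * (1 / 2) ^ k ≤ ε →
    ∫ x, (E (k * (46 + 444 * (d - 1))) f x - E k f x) ^ 2 ≤ ε ^ 6 / 256 →
    ∃ x t : ℝ, ((1 / 2) ^ k) ^ 9 ≤ t ∧ f x ≠ 0 ∧ f (x + lam * t) ≠ 0 ∧ f (x + Q.eval t) ≠ 0 := by
  have hd1 : (1:ℝ) ≤ d := by exact_mod_cast hd.le
  obtain ⟨C, hC, hP⟩ := propA (d * (d * M)) (by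
    have := mul_le_mul hd1 (mul_le_mul hd1 hM (by norm_num) (by linarith)) (by norm_num) (by linarith)
    linarith) d hd
  obtain ⟨C2, hC2, hW⟩ := weight
  refine ⟨128 * M + 4 * (C * C2), by nlinarith, ?_⟩
  intro f lam Q ε k hf hε hε1 hm hl hl1 hQm hQd hQ0 hQc hA hE
  set ℓ : ℝ := (1 / 2) ^ k with hℓ
  set B : ℕ := 46 + 444 * (d - 1) with hB
  have hℓ0 : 0 < ℓ := by positivity
  have hCC : 1 ≤ C * C2 := by nlinarith
  have hMℓ : 128 * M * ℓ ≤ ε := by nlinarith [mul_pos hℓ0 (by linarith : 0 < C * C2)]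
  have hCℓ : 4 * (C * C2) * ℓ ≤ 1 := by nlinarith [mul_pos hℓ0 (by linarith : 0 < M)]
  have h128 : 128 * ℓ ≤ ε := by nlinarith
  have hℓε : ℓ ≤ ε := by linarith
  have hℓ1 : ℓ ≤ 1 := by linarith
  have h3 : ℓ ^ 3 ≤ ε ^ 3 := pow_le_pow_left₀ hℓ0.le hℓε 3
  set r : ℝ := ℓ ^ 5 with hr
  have hr0 : 0 < r := by positivity
  have hr1 : r ≤ 1 := pow_le_one₀ hℓ0.le hℓ1
  obtain ⟨χ, hχc, hχ0, hχ1, hχd, hχs, hχi⟩ := hW r (ℓ ^ 4) hr0 hr1 (by positivity) (pow_le_one₀ hℓ0.le hℓ1)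
  have e9 : ℓ ^ 4 * r = ℓ ^ 9 := by rw [hr]; ring
  rw [e9] at hχd hχs
  have h9 : 0 < ℓ ^ 9 := by positivity
  have hχs' : ∀ t, t ∉ Icc 0 r → χ t = 0 := fun t ht => hχs t fun h => ht ⟨h9.le.trans h.1, h.2⟩
  have hχs1 : ∀ t, t ∉ Icc (0:ℝ) 1 → χ t = 0 := fun t ht => hχs' t fun h => ht ⟨h.1, h.2.trans hr1⟩
  have hχm : Measurable χ := hχc.continuous.measurable
  have hχa : ∀ t, |χ t| ≤ 1 := fun t => by rw [abs_of_nonneg (hχ0 t)]; exact hχ1 t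
  have hχint : Integrable χ := bdd_integrable (B := Icc 0 r) (by simp) hχm hχa hχs'
  have hχr : ∫ t, |χ t| ≤ r := by
    have : ∫ t, |χ t| ≤ ∫ t, (Icc 0 r).indicator (fun _ => (1:ℝ)) t := by
      refine integral_mono hχint.abs ((integrable_indicator_iff measurableSet_Icc).2
        (integrableOn_const (by rw [Real.volume_Icc]; exact ENNReal.ofReal_ne_top))) fun t => ?_
      by_cases ht : t ∈ Icc 0 r
      · simp only [ht, indicator_of_mem]; exact hχa t
      · simp [ht, hχs' t ht]
    rw [integral_indicator_const _ measurableSet_Icc, Measure.real, Real.volume_Icc,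
        ENNReal.toReal_ofReal (by linarith)] at this
    simpa using this
  set q : ℝ → ℝ := fun t => Q.eval t with hq
  have hqm : Measurable q := Q.continuous.measurable
  have n1 := E_nice hf k
  have n2 := E_nice hf (k * B)
  -- main term
  have m1 := main_term (q := q) (M := M) hf hl hr0 (k := k) (by
    rw [← hℓ]
    calc lam * r ≤ 1 * r := mul_le_mul_of_nonneg_right hl1 hr0.le
      _ = ℓ ^ 5 := by rw [one_mul]
      _ ≤ ℓ := pow_le_of_le_one hℓ0.le hℓ1 (by norm_num)) hqm (by linarith)
    (fun t ht => (eval_cs_lin hQd.le hQ0 ⟨ht.1, ht.2.trans hr1⟩).trans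
      (mul_le_mul_of_nonneg_right hQc ht.1)) hχm hχ0 hχ1 hχs' hχi
  have k2 : (2:ℝ) ^ k * ℓ = 1 := by rw [hℓ, ← mul_pow]; norm_num
  have m2 : 4 * 2 ^ k * M * r ^ 2 ≤ r * ε ^ 3 / 32 := by
    have : 4 * 2 ^ k * M * r ^ 2 = r * (4 * M * ℓ ^ 4 * (2 ^ k * ℓ)) := by rw [hr]; ring
    rw [this, k2, mul_one]
    have : 128 * M * ℓ * ℓ ^ 3 ≤ 1 * ε ^ 3 := mul_le_mul (by linarith) h3 (by positivity) zero_le_one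
    have : r * (128 * M * ℓ * ℓ ^ 3) ≤ r * (1 * ε ^ 3) := mul_le_mul_of_nonneg_left this hr0.le
    linarith
  have m3 : 4 * ℓ ^ 4 * r ≤ r * ε ^ 3 / 32 := by
    have : 128 * ℓ * ℓ ^ 3 ≤ 1 * ε ^ 3 := mul_le_mul (by linarith) h3 (by positivity) zero_le_one
    have : r * (128 * ℓ * ℓ ^ 3) ≤ r * (1 * ε ^ 3) := mul_le_mul_of_nonneg_left this hr0.le
    linarith
  -- energy term
  have t1 := (Lam_intble (lam := lam) hqm hχm hf.meas hf.meas (n2.meas.sub n1.meas) hf.abs_le hf.abs_le hχint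
    (n2.intble.sub n1.intble)).2
  have habs : ∀ x, |E (k * B) f x - E k f x| ≤ 1 := fun x => by
    rw [abs_le]; constructor <;> linarith [n1.nonneg x, n1.le_one x, n2.nonneg x, n2.le_one x]
  have t2 : ∫ x, |E (k * B) f x - E k f x| ≤ ε ^ 3 / 16 := by
    have hmm : Measurable fun x => |E (k * B) f x - E k f x| := (n2.meas.sub n1.meas).norm
    have hz : ∀ x, x ∉ Ico (0:ℝ) 1 → |E (k * B) f x - E k f x| = 0 := fun x hx => by
      rw [n1.zero x hx, n2.zero x hx]; simp
    have := cs_ineq (μ := volume) (u := fun _ => (1:ℝ)) (F := fun x => |E (k * B) f x - E k f x|) (B := Ico (0:ℝ) 1)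
      (V := 1) one_pos measurableSet_Ico (by simp) (by simp) measurable_const (by simp) hmm
      (bdd_integrable (B := Ico (0:ℝ) 1) (C := 1) (by simp) (hmm.pow_const 2) (fun x => by
        rw [abs_pow, abs_abs]; exact pow_le_one₀ (abs_nonneg _) (habs x)) (fun x hx => by rw [hz x hx]; norm_num))
      (n2.intble.sub n1.intble).abs (fun x hx => by rw [hz x hx, mul_zero])
    simp only [one_mul, sq_abs] at this
    refine le_of_sq_le_sq ?_ (by positivity)
    refine (this.trans hE).trans (le_of_eq (by ring))
  have t3 : |Lam lam q χ f f (fun t => E (k * B) f t - E k f t)| ≤ r * ε ^ 3 / 16 := by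
    refine t1.trans ?_
    calc _ ≤ ε ^ 3 / 16 * r := mul_le_mul t2 hχr (integral_nonneg fun _ => abs_nonneg _) (by positivity)
      _ = _ := by ring
  -- oscillatory term
  have hX0 : ℓ ^ 9 ≤ r * ε ^ 3 / 32 := by
    have : 32 * ℓ * ℓ ^ 3 ≤ 1 * ε ^ 3 := mul_le_mul (by linarith) h3 (by positivity) zero_le_one
    have : r * (32 * ℓ * ℓ ^ 3) ≤ r * (1 * ε ^ 3) := mul_le_mul_of_nonneg_left this hr0.le
    have : r * (32 * ℓ * ℓ ^ 3) = 32 * ℓ ^ 9 := by rw [hr]; ring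
    linarith
  have hcs1 : cs Q.derivative d ≤ d * M := (cs_deriv hQd.le).trans (mul_le_mul_of_nonneg_left hQc (by linarith))
  have hdd1 : Q.derivative.natDegree ≤ d := (Polynomial.natDegree_derivative_le Q).trans (by omega)
  have hdd2 : Q.derivative.derivative.natDegree ≤ d :=
    (Polynomial.natDegree_derivative_le Q.derivative).trans (by omega)
  have hcs2 : cs Q.derivative.derivative d ≤ d * (d * M) :=
    (cs_deriv hdd1).trans (mul_le_mul_of_nonneg_left hcs1 (by linarith))
  have hMd : M ≤ d * M := le_mul_of_one_le_left (by linarith) hd1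
  have hMdd : d * M ≤ d * (d * M) := le_mul_of_one_le_left (by positivity) hd1
  have o1 : |Lam lam q χ f f (fun t => f t - E (k * B) f t)| ≤ r * ε ^ 3 / 32 := by
    refine hP lam Q χ f f (fun t => f t - E (k * B) f t) (C2 / ℓ ^ 9) (2 * ℓ ^ B) (ℓ ^ 37) (r * ε ^ 3 / 32) hQm hQd
      hl.le hl1 (fun t ht => (eval_cs hQd.le ht).trans (by linarith)) (fun t ht => (eval_cs hdd1 ht).trans (by linarith))
      (fun t ht => (eval_cs hdd2 ht).trans hcs2) hχc hχa hχd ?_ hχs1 hf.meas hf.abs_le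
      (fun t ht => hf.zero t fun h => ht ⟨h.1, by linarith [h.2]⟩) hf.meas hf.abs_le (hf.meas.sub n2.meas) ?_ ?_ ?_
      (by positivity) (by positivity) (pow_le_one₀ hℓ0.le hℓ1) (by positivity) ?_
    · rw [le_div_iff₀ h9]
      have : ℓ ^ 9 ≤ 1 := pow_le_one₀ hℓ0.le hℓ1
      linarith
    · intro x
      rw [abs_le]; constructor <;> linarith [hf.nonneg x, hf.le_one x, n2.nonneg x, n2.le_one x]
    · intro x hx
      have hx' : x ∉ Ico (0:ℝ) 1 := fun h => hx ⟨h.1, by linarith [h.2]⟩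
      show f x - E (k * B) f x = 0
      rw [hf.zero x hx', n2.zero x hx', sub_zero]
    · intro y
      refine (prim_bd hf (k * B) y).trans (le_of_eq ?_)
      rw [hℓ, ← pow_mul, one_div_pow]
    · have eB : 2 * ℓ ^ B * (C2 / ℓ ^ 9) / ((ℓ ^ 37) ^ (6 * (d - 1))) ^ 2 = 2 * C2 * ℓ ^ 37 := by
        rw [← pow_mul ℓ 37, ← pow_mul ℓ, mul_div_assoc', div_div, div_eq_iff (by positivity)]
        have : B = 37 + (9 + 37 * (6 * (d - 1)) * 2) := by omega
        rw [this, pow_add, pow_add]; ring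
      rw [eB]
      calc C * (2 * C2 * ℓ ^ 37 + ℓ ^ 37) = C * (2 * C2 + 1) * ℓ * ℓ ^ 36 := by ring
        _ ≤ 1 * ℓ ^ 36 := by
          refine mul_le_mul_of_nonneg_right ?_ (by positivity)
          have : C * (2 * C2 + 1) ≤ 4 * (C * C2) := by nlinarith
          exact (mul_le_mul_of_nonneg_right this hℓ0.le).trans hCℓ
        _ = (ℓ ^ 9) ^ 4 := by ring
        _ ≤ _ := pow_le_pow_left₀ h9.le hX0 4
  have s1 := Lam_sub (lam := lam) hqm hχm hf.meas hf.meas n2.meas n1.meas hf.abs_le hf.abs_le hχint n2.intble n1.intble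
  have s2 := Lam_sub (lam := lam) hqm hχm hf.meas hf.meas hf.meas n2.meas hf.abs_le hf.abs_le hχint hf.intble n2.intble
  rw [s1] at t3
  rw [s2] at o1
  have hm3 : r * ε ^ 3 ≤ r * (∫ x, f x) ^ 3 := mul_le_mul_of_nonneg_left (pow_le_pow_left₀ hε.le hm 3) hr0.le
  have hrε : 0 < r * ε ^ 3 := by positivity
  have hpos : 0 < Lam lam q χ f f f := by
    have := (abs_le.1 t3).1
    have := (abs_le.1 o1).1
    linarith
  by_contra hcon
  push Not at hcon
  have : Lam lam q χ f f f = 0 := by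
    unfold Lam
    rw [← integral_zero (ℝ × ℝ) ℝ]
    congr 1
    funext p
    by_cases hp : p.2 ∈ Icc (ℓ ^ 9) r
    · by_cases h1 : f p.1 = 0
      · simp [h1]
      by_cases h2 : f (p.1 + lam * p.2) = 0
      · simp [h2]
      have := hcon p.1 p.2 hp.1 h1 h2
      simp [hq, this]
    · simp [hχs p.2 hp]
  linarith

end PR

namespace PR

theorem pigeon {f : ℝ → ℝ} (hf : Nice f) {ε : ℝ} (hε : 0 < ε) (k₀ B : ℕ) (hB : 1 ≤ B) :
    ∃ j : ℕ, (j:ℝ) ≤ 256 / ε ^ 6 ∧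
      ∫ x, (E (k₀ * B ^ j * B) f x - E (k₀ * B ^ j) f x) ^ 2 ≤ ε ^ 6 / 256 := by
  set e : ℕ → ℝ := fun j => ∫ x, E (k₀ * B ^ j) f x ^ 2 with he
  have hε6 : 0 < ε ^ 6 := by positivity
  by_contra hcon
  push Not at hcon
  set J := ⌊256 / ε ^ 6⌋₊ with hJ
  have hJ1 : 256 / ε ^ 6 < (J:ℝ) + 1 := Nat.lt_floor_add_one _
  have hJ2 : (J:ℝ) ≤ 256 / ε ^ 6 := Nat.floor_le (by positivity)
  have hind : ∀ j : ℕ, j ≤ J + 1 → j * (ε ^ 6 / 256) ≤ e j := by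
    intro j
    induction j with
    | zero => intro _; simpa using integral_nonneg fun x => sq_nonneg _
    | succ j ih =>
      intro hj
      have h1 := ih (by omega)
      have h2 : (j:ℝ) ≤ 256 / ε ^ 6 := le_trans (by exact_mod_cast (by omega : j ≤ J)) hJ2
      have h3 := hcon j h2
      rw [energy hf (Nat.le_mul_of_pos_right _ hB)] at h3
      have h4 : e (j + 1) = ∫ x, E (k₀ * B ^ j * B) f x ^ 2 := by
        simp only [he, pow_succ, mul_assoc]
      rw [h4]
      push_cast
      simp only [he] at h1
      linarith
  have hlast := hind (J + 1) le_rfl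
  have n := E_nice hf (k₀ * B ^ (J + 1))
  have hle : e (J + 1) ≤ 1 := by
    have : e (J + 1) ≤ ∫ x, (Ico (0:ℝ) 1).indicator (fun _ => (1:ℝ)) x := by
      refine integral_mono_of_nonneg (Filter.Eventually.of_forall fun x => sq_nonneg _)
        ((integrable_indicator_iff measurableSet_Ico).2 (integrableOn_const (by simp)))
        (Filter.Eventually.of_forall fun x => ?_)
      show E (k₀ * B ^ (J + 1)) f x ^ 2 ≤ _
      by_cases hx : x ∈ Ico (0:ℝ) 1
      · rw [indicator_of_mem hx]; exact pow_le_one₀ (n.nonneg x) (n.le_one x)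
      · rw [indicator_of_notMem hx, n.zero x hx]; norm_num
    rw [integral_indicator_const _ measurableSet_Ico, Measure.real, Real.volume_Ico] at this
    simpa using this
  push_cast at hlast
  rw [div_lt_iff₀ hε6] at hJ1
  linarith

theorem normalized (M : ℝ) (d : ℕ) (hM : 1 ≤ M) (hd : 1 < d) : ∃ C : ℝ, 0 < C ∧
    ∀ (f : ℝ → ℝ) (lam : ℝ) (Q : Polynomial ℝ) (ε : ℝ), Nice f → 0 < ε → ε ≤ 1 → ε ≤ ∫ x, f x →
    0 < lam → lam ≤ 1 → Q.Monic → Q.natDegree = d → Q.coeff 0 = 0 → cs Q d ≤ M →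
    ∃ δ : ℝ, 0 < δ ∧ C * ε ≤ (Real.log (Real.log δ⁻¹)) ^ (-(1 / 6) : ℝ) ∧
    ∃ x t : ℝ, δ < t ∧ f x ≠ 0 ∧ f (x + lam * t) ≠ 0 ∧ f (x + Q.eval t) ≠ 0 := by
  obtain ⟨A, hA, hS⟩ := step M d hM hd
  set B : ℕ := 46 + 444 * (d - 1) with hB
  have hB1 : 1 ≤ B := by omega
  have hD : 0 < 20 * A + 256 * (B:ℝ) := by positivity
  refine ⟨(20 * A + 256 * (B:ℝ)) ^ (-(1 / 6) : ℝ), Real.rpow_pos_of_pos hD _, ?_⟩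
  intro f lam Q ε hf hε hε1 hm hl hl1 hQm hQd hQ0 hQc
  set k₀ := ⌈A / ε⌉₊ with hk₀
  have hk1 : A / ε ≤ k₀ := Nat.le_ceil _
  have hAε : A ≤ A / ε := by rw [le_div_iff₀ hε]; nlinarith
  have hk2 : (k₀:ℝ) ≤ 2 * (A / ε) := by
    have := Nat.ceil_lt_add_one (by positivity : 0 ≤ A / ε)
    linarith
  obtain ⟨j, hj, hE⟩ := pigeon hf hε k₀ B hB1
  set k := k₀ * B ^ j with hk
  have hkk : (k₀:ℝ) ≤ k := by
    exact_mod_cast Nat.le_mul_of_pos_right _ (pow_pos hB1 j)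
  have hk128 : (128:ℝ) ≤ k := by linarith
  have hAk : A * (1 / 2) ^ k ≤ ε := by
    have h1 : (k:ℝ) ≤ 2 ^ k := by exact_mod_cast Nat.lt_two_pow_self.le
    have h2 : A / ε ≤ 2 ^ k := by linarith
    rw [div_le_iff₀ hε] at h2
    rw [one_div_pow, mul_one_div, div_le_iff₀ (by positivity)]
    linarith
  obtain ⟨x, t, ht, h⟩ := hS f lam Q ε k hf hε hε1 hm hl hl1 hQm hQd hQ0 hQc hAk hE
  refine ⟨((1 / 2) ^ k) ^ 9 / 2, by positivity, ?_, x, t, lt_of_lt_of_le (half_lt_self (by positivity)) ht, h⟩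
  have e1 : (((1 / 2 : ℝ) ^ k) ^ 9 / 2)⁻¹ = 2 ^ (9 * k + 1) := by
    rw [inv_div, ← pow_mul, one_div_pow, div_div_eq_mul_div, div_one, pow_succ, mul_comm k 9, mul_comm]
  rw [e1, Real.log_pow]
  push_cast
  have l1 := Real.log_two_gt_d9
  have l2 := Real.log_two_lt_d9
  have g1 : 1 < (9 * (k:ℝ) + 1) * Real.log 2 := by nlinarith
  have g2 : (9 * (k:ℝ) + 1) * Real.log 2 ≤ 10 * k := by nlinarith
  have hY0 := Real.log_pos g1
  have hBr : (0:ℝ) < B := by exact_mod_cast hB1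
  have hk0p : (0:ℝ) < k₀ := by linarith
  have hY : Real.log ((9 * (k:ℝ) + 1) * Real.log 2) ≤ (20 * A + 256 * (B:ℝ)) * (ε ^ 6)⁻¹ := by
    have a1 : Real.log ((9 * (k:ℝ) + 1) * Real.log 2) ≤ Real.log (10 * k) := Real.log_le_log (by linarith) g2
    have a2 : Real.log (10 * k) = Real.log (10 * k₀) + j * Real.log B := by
      rw [hk]; push_cast
      rw [← mul_assoc, Real.log_mul (by positivity) (by positivity), Real.log_pow]
    have a3 : Real.log (10 * k₀) ≤ 10 * k₀ := (Real.log_le_sub_one_of_pos (by positivity)).trans (by linarith)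
    have a4 : Real.log B ≤ B := (Real.log_le_sub_one_of_pos hBr).trans (by linarith)
    have a5 : (j:ℝ) * Real.log B ≤ 256 / ε ^ 6 * B :=
      (mul_le_mul_of_nonneg_left a4 (Nat.cast_nonneg j)).trans (mul_le_mul_of_nonneg_right hj hBr.le)
    have a6 : A / ε ≤ A * (ε ^ 6)⁻¹ := by
      rw [div_eq_mul_inv]
      refine mul_le_mul_of_nonneg_left ?_ (by linarith)
      exact inv_anti₀ (by positivity) (pow_le_of_le_one hε.le hε1 (by norm_num))
    have a7 : 256 / ε ^ 6 * B = 256 * B * (ε ^ 6)⁻¹ := by ring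
    linarith
  have := Real.rpow_le_rpow_of_nonpos hY0 hY (by norm_num : (-(1 / 6) : ℝ) ≤ 0)
  refine le_trans (le_of_eq ?_) this
  rw [Real.mul_rpow hD.le (by positivity)]
  congr 1
  rw [← inv_pow, ← Real.rpow_natCast, ← Real.rpow_mul (by positivity), Real.inv_rpow hε.le, ← Real.rpow_neg hε.le]
  norm_num

end PR

/-- Polynomial Roth theorem on the real line (Durcik–Guo–Roos): positive density
subsets of `[0,N]` contain patterns `x, x+t, x+P(t)` with gap `t > δ N^(1/d)`,
where `(log log δ⁻¹)^(-1/6) ≳_{M,d} ε`. -/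
theorem stmt6 (M : ℝ) (d : ℕ) (hM : 1 ≤ M) (hd : 1 < d) :
    ∃ C > (0 : ℝ), ∀ N ε : ℝ, 1 ≤ N → 0 < ε →
      ∀ S : Set ℝ, MeasurableSet S → S ⊆ Set.Icc 0 N →
        ε * N ≤ (volume S).toReal →
      ∀ P : Polynomial ℝ, P.Monic → P.natDegree = d → P.coeff 0 = 0 →
        (∑ i ∈ Finset.range (d + 1), |P.coeff i|) ≤ M →
      ∃ δ > (0 : ℝ), C * ε ≤ (Real.log (Real.log δ⁻¹)) ^ (-(1 / 6) : ℝ) ∧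
        ∃ x t : ℝ, δ * N ^ ((d : ℝ)⁻¹) < t ∧
          x ∈ S ∧ x + t ∈ S ∧ x + P.eval t ∈ S := by
  obtain ⟨C, hC, hn⟩ := PR.normalized M d hM hd
  refine ⟨C, hC, ?_⟩
  intro N ε hN hε S hS hSN hv P hPm hPd hP0 hPc
  have hN0 : 0 < N := by linarith
  set a : ℝ := N ^ ((d : ℝ)⁻¹) with ha
  have ha0 : 0 < a := Real.rpow_pos_of_pos hN0 _
  have had : a ^ d = N := Real.rpow_inv_natCast_pow hN0.le (by omega)
  have ha1 : 1 ≤ a := Real.one_le_rpow hN (by positivity)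
  have haN : a ≤ N := by
    rw [← had]; exact le_self_pow₀ ha1 (by omega)
  set Q : Polynomial ℝ := Polynomial.C N⁻¹ * P.comp (Polynomial.C a * Polynomial.X) with hQ
  have hQc : ∀ i, Q.coeff i = N⁻¹ * (P.coeff i * a ^ i) := fun i => by
    rw [hQ, Polynomial.coeff_C_mul, Polynomial.comp_C_mul_X_coeff]
  have hQd1 : Q.coeff d = 1 := by
    have : P.coeff d = 1 := by rw [← hPd]; exact hPm
    rw [hQc, this, had, one_mul, inv_mul_cancel₀ hN0.ne']
  have hQle : Q.natDegree ≤ d := by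
    rw [Polynomial.natDegree_le_iff_coeff_eq_zero]
    intro i hi
    rw [hQc, Polynomial.coeff_eq_zero_of_natDegree_lt (by omega)]; simp
  have hQm : Q.Monic := Polynomial.monic_of_natDegree_le_of_coeff_eq_one d hQle hQd1
  have hQd : Q.natDegree = d := Polynomial.natDegree_eq_of_le_of_coeff_ne_zero hQle (by rw [hQd1]; norm_num)
  have hQ0 : Q.coeff 0 = 0 := by rw [hQc, hP0]; simp
  have hQs : PR.cs Q d ≤ M := by
    refine le_trans (Finset.sum_le_sum fun i hi => ?_) hPc
    rw [hQc, abs_mul, abs_mul, abs_of_pos (inv_pos.2 hN0), abs_of_pos (pow_pos ha0 i), inv_mul_le_iff₀ hN0, mul_comm N]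
    refine mul_le_mul_of_nonneg_left ?_ (abs_nonneg _)
    rw [← had]
    exact pow_le_pow_right₀ ha1 (by have := Finset.mem_range.1 hi; omega)
  have hQe : ∀ s, N * Q.eval s = P.eval (a * s) := fun s => by
    rw [hQ]; simp [Polynomial.eval_comp]; field_simp
  set T : Set ℝ := (fun s => N * s) ⁻¹' S with hT
  have hTm : MeasurableSet T := (measurable_const_mul N) hS
  set f : ℝ → ℝ := (T ∩ Ico 0 1).indicator (fun _ => (1:ℝ)) with hf
  have hTI : MeasurableSet (T ∩ Ico (0:ℝ) 1) := hTm.inter measurableSet_Ico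
  have hfn : PR.Nice f := by
    refine ⟨measurable_const.indicator hTI, fun x => indicator_nonneg (fun _ _ => zero_le_one) x, fun x => ?_, fun x hx => ?_⟩
    · exact indicator_le_self' (fun _ _ => zero_le_one) x
    · exact indicator_of_notMem (fun h => hx h.2) _
  have hfT : ∀ x, f x ≠ 0 → N * x ∈ S := fun x hx => by
    by_contra h
    exact hx (indicator_of_notMem (fun h' => h h'.1) _)
  have hvT : (volume T).toReal = N⁻¹ * (volume S).toReal := by
    rw [hT, Real.volume_preimage_mul_left hN0.ne', ENNReal.toReal_mul, ENNReal.toReal_ofReal (abs_nonneg _),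
      abs_of_pos (inv_pos.2 hN0)]
  have hTs : T ⊆ Icc 0 1 := fun s hs => by
    have h := hSN hs
    exact ⟨by nlinarith [h.1], by nlinarith [h.2]⟩
  have hae : volume (T ∩ Ico (0:ℝ) 1) = volume T := by
    refine measure_congr ?_
    have : T ∩ Icc (0:ℝ) 1 = T := inter_eq_left.2 hTs
    conv_rhs => rw [← this]
    exact (ae_eq_refl T).inter Ico_ae_eq_Icc
  have hintg : ∫ x, f x = (volume T).toReal := by
    rw [hf, integral_indicator_const _ hTI, Measure.real, hae]; simp
  have hm : ε ≤ ∫ x, f x := by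
    rw [hintg, hvT, ← div_eq_inv_mul, le_div_iff₀ hN0]; exact hv
  have hε1 : ε ≤ 1 := by
    refine hm.trans ?_
    rw [hintg]
    have := ENNReal.toReal_mono (by simp) (measure_mono (μ := volume) hTs)
    simpa using this
  obtain ⟨δ, hδ, hlog, x, t, ht, h1, h2, h3⟩ := hn f (a / N) Q ε hfn hε hε1 hm (by positivity)
    ((div_le_one hN0).2 haN) hQm hQd hQ0 hQs
  refine ⟨δ, hδ, hlog, N * x, a * t, ?_, hfT _ h1, ?_, ?_⟩
  · rw [mul_comm]; exact mul_lt_mul_of_pos_left ht ha0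
  · have := hfT _ h2
    rwa [mul_add, ← mul_assoc, mul_div_cancel₀ _ hN0.ne'] at this
  · have := hfT _ h3
    rwa [mul_add, hQe] at this
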